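/- Error estimate for the Morley interpolation: Let T ∈ T_ℓ be a triangle and let T_{ℓ+m} be a regular triangulation of T. Then any v ∈ V + V_{ℓ+m} and its Morley interpolation I_ℓ v satisfy ‖h_T^{-2}(1−I_ℓ)v‖_{L²(T)} + ‖h_T^{-1} D_{NC}(1−I_ℓ)v‖_{L²(T)} ≲ ‖D²_{NC}(1−I_ℓ)v‖_{L²(T)}, with a constant that does not depend on the triangulation T_{ℓ+m}. -/

import Mathlib

open MeasureTheory
open scoped ENNReal RealInnerProductSpace Classical

noncomputable section

/-- Points of the plane. -/
abbrev E2 : Type := EuclideanSpace ℝ (Fin 2)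

/-- The closed triangle spanned by three points. -/
def tri (v : Fin 3 → E2) : Set E2 := convexHull ℝ (Set.range v)

/-- `𝒦` is a regular triangulation of the set `S`. -/
def IsRegularTriangulationOf (𝒦 : Finset (Fin 3 → E2)) (S : Set E2) : Prop :=
  (∀ K ∈ 𝒦, AffineIndependent ℝ K) ∧
  (⋃ K ∈ 𝒦, tri K) = S ∧
  (∀ K ∈ 𝒦, ∀ K' ∈ 𝒦, K ≠ K' →
    tri K ∩ tri K' = ∅ ∨
    (∃ i, tri K ∩ tri K' = {K i}) ∨
    (∃ i i', i ≠ i' ∧ tri K ∩ tri K' = segment ℝ (K i) (K i')))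

/-- Shape regularity with parameter `γ` (uniform on the admissible class
`𝕋` of newest-vertex bisection refinements of `T₀`, with `γ` depending only
on `T₀`). -/
def ShapeReg (γ : ℝ) (v : Fin 3 → E2) : Prop :=
  (Metric.diam (tri v)) ^ 2 ≤ γ * (volume (tri v)).toReal

/-- The mesh-size `h_T = |T|^{1/2}` of a triangle. -/
def hT (v : Fin 3 → E2) : ℝ := Real.sqrt ((volume (tri v)).toReal)

/-- A polynomial of degree at most `2` on the plane. -/
def IsQuadratic (q : E2 → ℝ) : Prop :=
  ∃ (B : E2 →ₗ[ℝ] E2 →ₗ[ℝ] ℝ) (L : E2 →ₗ[ℝ] ℝ) (c : ℝ),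
    ∀ x, q x = B x x + L x + c

/-- Membership in `V + V_{ℓ+m}`, localized to the triangle `T` triangulated
by `𝒦 = T_{ℓ+m}|_T`: the piecewise smooth function with pieces `v K`
(`K ∈ 𝒦`) is the sum of an `H²` function `w` (modelled as a `C²` function;
Mathlib has no Sobolev spaces, and the estimate follows for `H²` by
density) and of a Morley finite element function with pieces `m K`:
piecewise quadratic, continuous at the vertices of `𝒦`, and with normal
derivative continuous at the interior edges' midpoints (equivalently, for
piecewise quadratics, with edge-mean normal-derivative continuity). -/
def IsVPlusMorleyOn (𝒦 : Finset (Fin 3 → E2))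
    (v : (Fin 3 → E2) → E2 → ℝ) : Prop :=
  ∃ (w : E2 → ℝ) (m : (Fin 3 → E2) → E2 → ℝ),
    ContDiff ℝ 2 w ∧
    (∀ K ∈ 𝒦, ∀ x : E2, v K x = w x + m K x) ∧
    (∀ K ∈ 𝒦, IsQuadratic (m K)) ∧
    -- continuity at the vertices of 𝒦
    (∀ K ∈ 𝒦, ∀ K' ∈ 𝒦, ∀ a : Fin 3, K a ∈ tri K' → m K (K a) = m K' (K a)) ∧
    -- continuity of the normal derivative at the interior edges' midpoints
    (∀ K ∈ 𝒦, ∀ K' ∈ 𝒦, K ≠ K' → ∀ a b : Fin 3, a ≠ b →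
      tri K ∩ tri K' = segment ℝ (K a) (K b) →
      ∀ nv : E2, ⟪nv, K b - K a⟫ = 0 →
        fderiv ℝ (m K) (midpoint ℝ (K a) (K b)) nv
          = fderiv ℝ (m K') (midpoint ℝ (K a) (K b)) nv)

namespace MorleyInterp

/-- The affine parametrization of a triangle over the unit triangle. -/
def par (v : Fin 3 → E2) (z : ℝ × ℝ) : E2 := v 0 + z.1 • (v 1 - v 0) + z.2 • (v 2 - v 0)

/-- The unit triangle. -/
def refTri : Set (ℝ × ℝ) := {z | 0 ≤ z.1 ∧ 0 ≤ z.2 ∧ z.1 + z.2 ≤ 1}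

/-- Twice the signed area of a triangle. -/
def det3 (v : Fin 3 → E2) : ℝ :=
  (v 1 0 - v 0 0) * (v 2 1 - v 0 1) - (v 1 1 - v 0 1) * (v 2 0 - v 0 0)

/-- The barycentric coordinate belonging to the second vertex. -/
def cx (v : Fin 3 → E2) (x : E2) : ℝ :=
  ((x 0 - v 0 0) * (v 2 1 - v 0 1) - (x 1 - v 0 1) * (v 2 0 - v 0 0)) / det3 v

/-- The barycentric coordinate belonging to the third vertex. -/
def cy (v : Fin 3 → E2) (x : E2) : ℝ :=
  ((v 1 0 - v 0 0) * (x 1 - v 0 1) - (v 1 1 - v 0 1) * (x 0 - v 0 0)) / det3 v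

lemma par_cx_cy {v : Fin 3 → E2} (hv : det3 v ≠ 0) (x : E2) : par v (cx v x, cy v x) = x := by
  ext i
  fin_cases i <;> simp [par, cx, cy] <;> field_simp <;> simp only [det3] <;> ring

lemma cx_par {v : Fin 3 → E2} (hv : det3 v ≠ 0) (z : ℝ × ℝ) : cx v (par v z) = z.1 := by
  simp only [cx, par, PiLp.add_apply, PiLp.smul_apply, PiLp.sub_apply, smul_eq_mul]
  rw [div_eq_iff hv]; simp only [det3]; ring

lemma cy_par {v : Fin 3 → E2} (hv : det3 v ≠ 0) (z : ℝ × ℝ) : cy v (par v z) = z.2 := by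
  simp only [cy, par, PiLp.add_apply, PiLp.smul_apply, PiLp.sub_apply, smul_eq_mul]
  rw [div_eq_iff hv]; simp only [det3]; ring

lemma det3_ne_zero {v : Fin 3 → E2} (hv : AffineIndependent ℝ v) : det3 v ≠ 0 := by
  intro h
  rw [affineIndependent_iff_linearIndependent_vsub ℝ _ (0 : Fin 3)] at hv
  have key : ∀ a b : ℝ, a • (v 1 - v 0) + b • (v 2 - v 0) = 0 → a = 0 ∧ b = 0 := by
    intro a b hab
    have hv' := Fintype.linearIndependent_iff.1 hv
    have e1 : (1 : Fin 3) ≠ 0 := by decide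
    have e2 : (2 : Fin 3) ≠ 0 := by decide
    let g : {x : Fin 3 // x ≠ 0} → ℝ := fun x => if x.1 = 1 then a else b
    have hu : (Finset.univ : Finset {x : Fin 3 // x ≠ 0}) = {⟨1, e1⟩, ⟨2, e2⟩} := by
      ext ⟨x, hx⟩
      fin_cases x <;> simp at hx ⊢
    have := hv' g (by
      rw [hu, Finset.sum_pair (by simp)]
      simpa [g] using hab)
    exact ⟨by simpa [g] using this ⟨1, e1⟩, by simpa [g] using this ⟨2, e2⟩⟩
  have h1 := key (v 2 1 - v 0 1) (-(v 1 1 - v 0 1)) (by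
    ext i
    fin_cases i <;> simp
    · simp only [det3] at h; linarith
    · ring)
  have h2 := key (-(v 2 0 - v 0 0)) (v 1 0 - v 0 0) (by
    ext i
    fin_cases i <;> simp
    · ring
    · simp only [det3] at h; linarith)
  have h3 := key 0 1 (by
    ext i
    fin_cases i <;> simp
    · linarith [h2.1]
    · exact h1.1)
  exact one_ne_zero h3.2

lemma tri_eq_image (v : Fin 3 → E2) : tri v = par v '' refTri := by
  have hr : Set.range v = {v 0, v 1, v 2} := by
    ext x; simp [Fin.exists_fin_succ, eq_comm]
  rw [tri, hr]
  ext x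
  constructor
  · intro hx
    rw [convexHull_insert (by simp), convexHull_pair] at hx
    obtain ⟨a, ha, b, hb, hx⟩ := mem_convexJoin.1 hx
    rw [Set.mem_singleton_iff] at ha
    subst ha
    rw [segment_eq_image_lineMap] at hb hx
    obtain ⟨s, hs, rfl⟩ := hb
    obtain ⟨t, ht, rfl⟩ := hx
    refine ⟨(t * (1 - s), t * s), ⟨mul_nonneg ht.1 (by linarith [hs.2]), mul_nonneg ht.1 hs.1,
      by simp only; linarith [ht.2]⟩, ?_⟩
    simp only [par, AffineMap.lineMap_apply_module]
    module
  · rintro ⟨z, ⟨h1, h2, h3⟩, rfl⟩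
    have : par v z = (1 - z.1 - z.2) • v 0 + z.1 • v 1 + z.2 • v 2 := by
      simp only [par]; module
    rw [this]
    have hc := convex_convexHull ℝ ({v 0, v 1, v 2} : Set E2)
    have h0 : ∀ y ∈ ({v 0, v 1, v 2} : Set E2), y ∈ convexHull ℝ ({v 0, v 1, v 2} : Set E2) :=
      fun y hy => subset_convexHull _ _ hy
    have := hc.sum_mem (t := Finset.univ) (w := ![1 - z.1 - z.2, z.1, z.2])
      (z := ![v 0, v 1, v 2])
      (by intro i _; fin_cases i <;> simp <;> linarith)
      (by simp [Fin.sum_univ_three]; ring)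
      (by intro i _; fin_cases i <;> apply h0 <;> simp)
    simpa [Fin.sum_univ_three] using this

lemma par_mem_tri {v : Fin 3 → E2} (hv : det3 v ≠ 0) {z : ℝ × ℝ} :
    par v z ∈ tri v ↔ z ∈ refTri := by
  rw [tri_eq_image]
  constructor
  · rintro ⟨w, hw, h⟩
    have h1 := congrArg (cx v) h
    have h2 := congrArg (cy v) h
    rw [cx_par hv, cx_par hv] at h1
    rw [cy_par hv, cy_par hv] at h2
    rwa [← Prod.ext h1 h2]
  · exact fun h => ⟨z, h, rfl⟩

lemma mem_tri_iff {v : Fin 3 → E2} (hv : det3 v ≠ 0) {x : E2} :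
    x ∈ tri v ↔ 0 ≤ cx v x ∧ 0 ≤ cy v x ∧ cx v x + cy v x ≤ 1 := by
  rw [← par_cx_cy hv x, par_mem_tri hv, cx_par hv, cy_par hv]; rfl

lemma vertex_mem_tri (v : Fin 3 → E2) (i : Fin 3) : v i ∈ tri v :=
  subset_convexHull _ _ ⟨i, rfl⟩

lemma isCompact_tri (v : Fin 3 → E2) : IsCompact (tri v) :=
  (Set.finite_range v).isCompact_convexHull ℝ

lemma measurableSet_tri (v : Fin 3 → E2) : MeasurableSet (tri v) :=
  (isCompact_tri v).isClosed.measurableSet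

lemma dist_le_diam (v : Fin 3 → E2) {x y : E2} (hx : x ∈ tri v) (hy : y ∈ tri v) :
    ‖x - y‖ ≤ Metric.diam (tri v) := by
  rw [← dist_eq_norm]
  exact Metric.dist_le_diam_of_mem (isCompact_tri v).isBounded hx hy

@[fun_prop]
lemma continuous_par (v : Fin 3 → E2) : Continuous (par v) := by
  unfold par; fun_prop

@[fun_prop]
lemma continuous_cx (v : Fin 3 → E2) : Continuous (cx v) := by
  unfold cx; fun_prop

@[fun_prop]
lemma continuous_cy (v : Fin 3 → E2) : Continuous (cy v) := by
  unfold cy; fun_prop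

/-- The parametrization as a homeomorphism of the plane. -/
def parHomeo (v : Fin 3 → E2) (hv : det3 v ≠ 0) : (ℝ × ℝ) ≃ₜ E2 where
  toFun := par v
  invFun x := (cx v x, cy v x)
  left_inv z := Prod.ext (cx_par hv z) (cy_par hv z)
  right_inv x := par_cx_cy hv x
  continuous_toFun := continuous_par v
  continuous_invFun := by fun_prop

lemma measurableEmbedding_par {v : Fin 3 → E2} (hv : det3 v ≠ 0) :
    MeasurableEmbedding (par v) :=
  (parHomeo v hv).measurableEmbedding

lemma map_par {v : Fin 3 → E2} (hv : det3 v ≠ 0) :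
    (volume : Measure (ℝ × ℝ)).map (par v) = ENNReal.ofReal |(det3 v)⁻¹| • volume := by
  set M : Matrix (Fin 2) (Fin 2) ℝ :=
    !![v 1 0 - v 0 0, v 2 0 - v 0 0; v 1 1 - v 0 1, v 2 1 - v 0 1] with hM
  have hdet : M.det = det3 v := by
    rw [hM, Matrix.det_fin_two_of, det3]; ring
  have h1 := Real.map_matrix_volume_pi_eq_smul_volume_pi (M := M) (by rwa [hdet])
  rw [hdet] at h1
  have h2 : par v = (fun x => x + v 0) ∘ (WithLp.toLp 2 : (Fin 2 → ℝ) → E2) ∘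
      (Matrix.toLin' M) ∘ (MeasurableEquiv.finTwoArrow (α := ℝ)).symm := by
    funext z
    ext i
    fin_cases i <;>
      simp [par, M, Matrix.toLin'_apply] <;> ring
  have m3 : Measurable (Matrix.toLin' M : (Fin 2 → ℝ) → (Fin 2 → ℝ)) :=
    (LinearMap.continuous_of_finiteDimensional _).measurable
  have m2 : Measurable (WithLp.toLp 2 : (Fin 2 → ℝ) → E2) :=
    (PiLp.volume_preserving_toLp (Fin 2)).measurable
  have m1 : Measurable (fun x : E2 => x + v 0) := by fun_prop
  rw [h2, ← Measure.map_map m1 (m2.comp (m3.comp (MeasurableEquiv.measurable _))),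
    ← Measure.map_map m2 (m3.comp (MeasurableEquiv.measurable _)),
    ← Measure.map_map m3 (MeasurableEquiv.measurable _),
    (volume_preserving_finTwoArrow ℝ).symm.map_eq, h1, Measure.map_smul,
    (PiLp.volume_preserving_toLp (Fin 2)).map_eq, Measure.map_smul, map_add_right_eq_self]

lemma lintegral_par {v : Fin 3 → E2} (hv : det3 v ≠ 0) (F : E2 → ℝ≥0∞) :
    ∫⁻ x, F x = ENNReal.ofReal |det3 v| * ∫⁻ z, F (par v z) := by
  have h := (measurableEmbedding_par hv).lintegral_map (μ := volume) F
  rw [map_par hv, lintegral_smul_measure] at h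
  rw [← h, smul_eq_mul, ← mul_assoc, ← ENNReal.ofReal_mul (abs_nonneg _), ← abs_mul,
    mul_inv_cancel₀ hv]
  simp

lemma setLIntegral_par {v : Fin 3 → E2} (hv : det3 v ≠ 0) (F : E2 → ℝ≥0∞) {S : Set E2}
    (hS : MeasurableSet S) :
    ∫⁻ x in S, F x = ENNReal.ofReal |det3 v| * ∫⁻ z in par v ⁻¹' S, F (par v z) := by
  rw [← lintegral_indicator hS, lintegral_par hv,
    ← lintegral_indicator ((continuous_par v).measurable hS)]
  rfl

lemma volume_tri_le {v : Fin 3 → E2} (hv : det3 v ≠ 0) :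
    volume (tri v) ≤ ENNReal.ofReal |det3 v| := by
  have h := setLIntegral_par hv (fun _ => 1) (measurableSet_tri v)
  have hp : par v ⁻¹' tri v ⊆ Set.Icc 0 1 ×ˢ Set.Icc 0 1 := by
    intro z hz
    obtain ⟨h1, h2, h3⟩ := (par_mem_tri hv).1 hz
    exact ⟨⟨h1, by linarith⟩, ⟨h2, by linarith⟩⟩
  have h1 : volume (par v ⁻¹' tri v) ≤ 1 := by
    refine (measure_mono hp).trans ?_
    rw [Measure.volume_eq_prod, Measure.prod_prod]
    simp
  rw [setLIntegral_one, setLIntegral_one] at h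
  rw [h]
  exact (mul_le_mul_right h1 _).trans (by simp)

/-- The triangle with vertices reordered. -/
lemma tri_perm (v : Fin 3 → E2) (σ : Equiv.Perm (Fin 3)) : tri (v ∘ σ) = tri v := by
  rw [tri, tri, EquivLike.range_comp]

lemma exists_perm {i j : Fin 3} (h : i ≠ j) : ∃ σ : Equiv.Perm (Fin 3), σ 0 = i ∧ σ 1 = j := by
  revert i j; decide

/-- Values attached to the pieces of a finite closed cover of a connected set differ by at most
twice the total radius, if neighbouring values are compatible with the radii. -/
lemma abs_sub_le_of_chain {ι : Type*} (s : Finset ι) (I : ι → Set ℝ)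
    (hI : ∀ i ∈ s, IsClosed (I i)) {J : Set ℝ} (hJ : IsPreconnected J)
    (hJI : J ⊆ ⋃ i ∈ s, I i) (c r : ι → ℝ)
    (h : ∀ i ∈ s, ∀ j ∈ s, (J ∩ (I i ∩ I j)).Nonempty → |c i - c j| ≤ r i + r j)
    (hr : ∀ i ∈ s, 0 ≤ r i) {i j : ι} (hi : i ∈ s) (hj : j ∈ s)
    (hiJ : (J ∩ I i).Nonempty) (hjJ : (J ∩ I j).Nonempty) :
    |c i - c j| ≤ 2 * ∑ k ∈ s, r k := by
  let adj : ι → ι → Prop := fun k l => k ∈ s ∧ l ∈ s ∧ (J ∩ (I k ∩ I l)).Nonempty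
  have hreach : Relation.ReflTransGen adj i j := by
    by_contra hcon
    set C1 := ⋃ k ∈ s.filter (fun k => Relation.ReflTransGen adj i k), I k
    set C2 := ⋃ k ∈ s.filter (fun k => ¬ Relation.ReflTransGen adj i k), I k
    have hc1 : IsClosed C1 := isClosed_biUnion_finset fun k hk => hI k (Finset.mem_filter.1 hk).1
    have hc2 : IsClosed C2 := isClosed_biUnion_finset fun k hk => hI k (Finset.mem_filter.1 hk).1
    have hcov : J ⊆ C1 ∪ C2 := by
      intro x hx
      obtain ⟨k, hk, hxk⟩ := Set.mem_iUnion₂.1 (hJI hx)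
      by_cases hkr : Relation.ReflTransGen adj i k
      · exact Or.inl (Set.mem_iUnion₂.2 ⟨k, Finset.mem_filter.2 ⟨hk, hkr⟩, hxk⟩)
      · exact Or.inr (Set.mem_iUnion₂.2 ⟨k, Finset.mem_filter.2 ⟨hk, hkr⟩, hxk⟩)
    have h1 : (J ∩ C1).Nonempty := hiJ.mono (Set.inter_subset_inter_right _
      (Set.subset_biUnion_of_mem (u := I) (Finset.mem_filter.2 ⟨hi, .refl⟩)))
    have h2 : (J ∩ C2).Nonempty := hjJ.mono (Set.inter_subset_inter_right _
      (Set.subset_biUnion_of_mem (u := I) (Finset.mem_filter.2 ⟨hj, hcon⟩)))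
    obtain ⟨x, hxJ, hx1, hx2⟩ := isPreconnected_closed_iff.1 hJ C1 C2 hc1 hc2 hcov h1 h2
    obtain ⟨k, hk, hxk⟩ := Set.mem_iUnion₂.1 hx1
    obtain ⟨l, hl, hxl⟩ := Set.mem_iUnion₂.1 hx2
    rw [Finset.mem_filter] at hk hl
    exact hl.2 (hk.2.tail ⟨hk.1, hl.1, x, hxJ, hxk, hxl⟩)
  have hsub : Set.uIcc (c i) (c j) ⊆ ⋃ k ∈ s, Metric.closedBall (c k) (r k) := by
    induction hreach with
    | refl =>
      rw [Set.uIcc_self, Set.singleton_subset_iff]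
      exact Set.mem_iUnion₂.2 ⟨i, hi, Metric.mem_closedBall_self (hr i hi)⟩
    | @tail k l _ hkl ih =>
      obtain ⟨hk, hl, hne⟩ := hkl
      refine Set.uIcc_subset_uIcc_union_uIcc.trans (Set.union_subset
        (ih hk (hne.mono fun x hx => ⟨hx.1, hx.2.1⟩)) ?_)
      intro x hx
      have hd := h k hk l hl hne
      have hx' : |x - c k| + |x - c l| = |c k - c l| := by
        rcases Set.mem_uIcc.1 hx with hx | hx
        · rw [abs_of_nonneg (by linarith), abs_of_nonpos (by linarith),
            abs_of_nonpos (by linarith)]; ring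
        · rw [abs_of_nonpos (by linarith), abs_of_nonneg (by linarith),
            abs_of_nonneg (by linarith)]; ring
      by_cases hxk : |x - c k| ≤ r k
      · exact Set.mem_iUnion₂.2 ⟨k, hk, by rwa [Metric.mem_closedBall, Real.dist_eq]⟩
      · exact Set.mem_iUnion₂.2 ⟨l, hl, by
          rw [Metric.mem_closedBall, Real.dist_eq]; linarith⟩
  have hvol := (measure_mono hsub).trans (measure_biUnion_finset_le (μ := volume) s _)
  simp only [Real.volume_closedBall, Real.volume_interval] at hvol
  rw [← ENNReal.ofReal_sum_of_nonneg (fun k hk => by linarith [hr k hk]),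
    ENNReal.ofReal_le_ofReal_iff (Finset.sum_nonneg fun k hk => by linarith [hr k hk]),
    ← Finset.mul_sum, abs_sub_comm] at hvol
  exact hvol

/-- Total variation bound along a line. -/
lemma enorm_sub_le_lintegral {φ : ℝ → ℝ} (hφ : ContDiff ℝ 1 φ) {S : Set ℝ} (hS : S.OrdConnected)
    {x y : ℝ} (hx : x ∈ S) (hy : y ∈ S) : ‖φ x - φ y‖ₑ ≤ ∫⁻ t in S, ‖deriv φ t‖ₑ := by
  wlog hxy : y ≤ x generalizing x y
  · rw [enorm_sub_rev]
    exact this hy hx (le_of_not_ge hxy)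
  have hd : Continuous (deriv φ) := hφ.continuous_deriv le_rfl
  rw [← intervalIntegral.integral_deriv_eq_sub
    (fun t _ => (hφ.differentiable one_ne_zero).differentiableAt) (hd.intervalIntegrable _ _),
    intervalIntegral.integral_of_le hxy]
  refine (enorm_integral_le_lintegral_enorm _).trans (lintegral_mono_set ?_)
  exact (Set.Ioc_subset_Icc_self).trans (hS.out hy hx)

/-- On almost every horizontal line, the pieces of `g` oscillate by at most `A`. -/
def LineBound {ι : Type*} (s : Finset ι) (S : ι → Set (ℝ × ℝ)) (g : ι → ℝ × ℝ → ℝ)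
    (A : ℝ → ℝ≥0∞) : Prop :=
  ∀ᵐ y : ℝ, ∀ k ∈ s, ∀ l ∈ s, ∀ x x' : ℝ, (x, y) ∈ S k → (x', y) ∈ S l →
    ‖g k (x, y) - g l (x', y)‖ₑ ≤ A y

/-- Piecewise functions with small variation along lines and vanishing mean on an edge are small
on that edge. -/
lemma lintegral_edge_le {ι : Type*} (s : Finset ι) (S : ι → Set (ℝ × ℝ))
    (g : ι → ℝ × ℝ → ℝ) {A B : ℝ → ℝ≥0∞} (hA : Measurable A) (hB : Measurable B)
    (hcov : refTri ⊆ ⋃ k ∈ s, S k) (hAb : LineBound s S g A)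
    (hBb : LineBound s (fun k => Prod.swap ⁻¹' S k) (fun k z => g k z.swap) B)
    {b : ℝ → ℝ} (hb : IntegrableOn b (Set.Icc 0 1)) (hb0 : ∫ t in Set.Icc (0 : ℝ) 1, b t = 0)
    (hbg : ∀ᵐ t : ℝ, t ∈ Set.Icc (0 : ℝ) 1 → ∀ k ∈ s, (t, (0 : ℝ)) ∈ S k → b t = g k (t, 0)) :
    ∫⁻ t in Set.Icc (0 : ℝ) 1, ‖b t‖ₑ ≤ 2 * ((∫⁻ y, A y) + ∫⁻ x, B x) := by
  have hA' := (Measure.measurePreserving_sub_left (volume : Measure ℝ) 1).quasiMeasurePreserving.ae hAb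
  set μ := (volume : Measure ℝ).restrict (Set.Icc 0 1) with hμ
  have hμ1 : IsProbabilityMeasure μ := ⟨by simp [μ]⟩
  set G : ℝ → ℝ≥0∞ := fun t => B t + A (1 - t) with hG
  have hGm : Measurable G := hB.add (hA.comp (measurable_const.sub measurable_id))
  have hex : ∀ z ∈ refTri, ∃ k ∈ s, z ∈ S k := fun z hz => by
    simpa using hcov hz
  have hgood : ∀ᵐ t ∂μ, t ∈ Set.Icc (0 : ℝ) 1 ∧
      (∀ k ∈ s, (t, (0 : ℝ)) ∈ S k → b t = g k (t, 0)) ∧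
      (∀ k ∈ s, ∀ l ∈ s, ∀ y y' : ℝ, (t, y) ∈ S k → (t, y') ∈ S l →
        ‖g k (t, y) - g l (t, y')‖ₑ ≤ B t) ∧
      (∀ k ∈ s, ∀ l ∈ s, ∀ x x' : ℝ, (x, 1 - t) ∈ S k → (x', 1 - t) ∈ S l →
        ‖g k (x, 1 - t) - g l (x', 1 - t)‖ₑ ≤ A (1 - t)) := by
    rw [hμ, ae_restrict_iff' measurableSet_Icc]
    filter_upwards [hA', hBb, hbg] with t h1 h2 h3 ht
    exact ⟨ht, h3 ht, h2, h1⟩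
  have hlt : ∀ a c : ℝ, a < c → a ∈ Set.Icc (0 : ℝ) 1 → c ∈ Set.Icc (0 : ℝ) 1 →
      (∀ k ∈ s, (a, (0 : ℝ)) ∈ S k → b a = g k (a, 0)) →
      (∀ k ∈ s, (c, (0 : ℝ)) ∈ S k → b c = g k (c, 0)) →
      (∀ k ∈ s, ∀ l ∈ s, ∀ y y' : ℝ, (a, y) ∈ S k → (a, y') ∈ S l →
        ‖g k (a, y) - g l (a, y')‖ₑ ≤ B a) →
      (∀ k ∈ s, ∀ l ∈ s, ∀ y y' : ℝ, (c, y) ∈ S k → (c, y') ∈ S l →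
        ‖g k (c, y) - g l (c, y')‖ₑ ≤ B c) →
      (∀ k ∈ s, ∀ l ∈ s, ∀ x x' : ℝ, (x, 1 - c) ∈ S k → (x', 1 - c) ∈ S l →
        ‖g k (x, 1 - c) - g l (x', 1 - c)‖ₑ ≤ A (1 - c)) →
      ‖b a - b c‖ₑ ≤ G a + G c := by
    intro a c hac ha hc hba hbc hBa hBc hAc
    obtain ⟨k1, hk1, h1⟩ := hex (a, 0) ⟨ha.1, le_rfl, by simpa using ha.2⟩
    obtain ⟨k2, hk2, h2⟩ := hex (a, 1 - c) ⟨ha.1, by simpa using hc.2, by simp only; linarith⟩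
    obtain ⟨k3, hk3, h3⟩ := hex (c, 1 - c) ⟨hc.1, by simpa using hc.2, by simp only; linarith⟩
    obtain ⟨k4, hk4, h4⟩ := hex (c, 0) ⟨hc.1, le_rfl, by simpa using hc.2⟩
    rw [hba k1 hk1 h1, hbc k4 hk4 h4]
    have e : g k1 (a, 0) - g k4 (c, 0) = (g k1 (a, 0) - g k2 (a, 1 - c)) +
      (g k2 (a, 1 - c) - g k3 (c, 1 - c)) + (g k3 (c, 1 - c) - g k4 (c, 0)) := by ring
    rw [e]
    calc _ ≤ B a + A (1 - c) + B c := (enorm_add_le _ _).trans (add_le_add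
            ((enorm_add_le _ _).trans (add_le_add (hBa _ hk1 _ hk2 _ _ h1 h2)
              (hAc _ hk2 _ hk3 _ _ h2 h3))) (hBc _ hk3 _ hk4 _ _ h3 h4))
      _ ≤ (B a + A (1 - a)) + (B c + A (1 - c)) := by
        rw [add_assoc, add_comm (A (1 - c))]
        gcongr
        exact le_self_add
  have hpair : ∀ᵐ a ∂μ, ∀ᵐ c ∂μ, ‖b a - b c‖ₑ ≤ G a + G c := by
    filter_upwards [hgood] with a ha
    filter_upwards [hgood] with c hc
    rcases lt_trichotomy a c with h | h | h
    · exact hlt a c h ha.1 hc.1 ha.2.1 hc.2.1 ha.2.2.1 hc.2.2.1 hc.2.2.2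
    · subst h; simp
    · rw [enorm_sub_rev, add_comm]
      exact hlt c a h hc.1 ha.1 hc.2.1 ha.2.1 hc.2.2.1 ha.2.2.1 ha.2.2.2
  have hpt : ∀ᵐ a ∂μ, ‖b a‖ₑ ≤ G a + ∫⁻ c, G c ∂μ := by
    filter_upwards [hpair] with a ha
    have : b a = ∫ c, (b a - b c) ∂μ := by
      rw [integral_sub (integrable_const _) hb, hb0]; simp
    rw [this]
    refine (enorm_integral_le_lintegral_enorm _).trans ((lintegral_mono_ae ha).trans ?_)
    rw [lintegral_add_left measurable_const]; simp
  have hGint : ∫⁻ c, G c ∂μ ≤ (∫⁻ y, A y) + ∫⁻ x, B x := by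
    refine (setLIntegral_le_lintegral _ _).trans ?_
    rw [hG, lintegral_add_left hB, add_comm]
    exact add_le_add (le_of_eq ((Measure.measurePreserving_sub_left
      (volume : Measure ℝ) 1).lintegral_comp hA)) le_rfl
  calc _ ≤ ∫⁻ a, (G a + ∫⁻ c, G c ∂μ) ∂μ := lintegral_mono_ae hpt
    _ = 2 * ∫⁻ c, G c ∂μ := by
      rw [lintegral_add_left hGm]; simp [two_mul]
    _ ≤ _ := by gcongr

/-- The planar Gagliardo–Nirenberg argument for piecewise functions on the unit triangle. -/
lemma sum_lintegral_sq_le {ι : Type*} (s : Finset ι) (S : ι → Set (ℝ × ℝ))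
    (g : ι → ℝ × ℝ → ℝ) {A B : ℝ → ℝ≥0∞} (hA : Measurable A) (hB : Measurable B)
    (hS : ∀ k ∈ s, MeasurableSet (S k)) (hcov : ⋃ k ∈ s, S k = refTri)
    (hdisj : ∀ k ∈ s, ∀ l ∈ s, k ≠ l → volume (S k ∩ S l) = 0)
    (hAb : LineBound s S g A)
    (hBb : LineBound s (fun k => Prod.swap ⁻¹' S k) (fun k z => g k z.swap) B)
    {α β : ℝ → ℝ≥0∞} (hαm : AEMeasurable α (volume.restrict (Set.Icc 0 1)))
    (hβm : AEMeasurable β (volume.restrict (Set.Icc 0 1)))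
    (hα : ∀ᵐ t : ℝ, t ∈ Set.Icc (0 : ℝ) 1 → ∀ k ∈ s, (t, (0 : ℝ)) ∈ S k → ‖g k (t, 0)‖ₑ ≤ α t)
    (hβ : ∀ᵐ t : ℝ, t ∈ Set.Icc (0 : ℝ) 1 → ∀ k ∈ s, ((0 : ℝ), t) ∈ S k → ‖g k (0, t)‖ₑ ≤ β t) :
    ∑ k ∈ s, ∫⁻ z in S k, ‖g k z‖ₑ ^ 2 ≤
      ((∫⁻ t in Set.Icc (0 : ℝ) 1, α t) + ∫⁻ x, B x) *
        ((∫⁻ t in Set.Icc (0 : ℝ) 1, β t) + ∫⁻ y, A y) := by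
  set μ := (volume : Measure ℝ).restrict (Set.Icc 0 1) with hμ
  have hsq : refTri ⊆ Set.Icc (0 : ℝ) 1 ×ˢ Set.Icc (0 : ℝ) 1 := by
    rintro z ⟨h1, h2, h3⟩
    exact ⟨⟨h1, by linarith⟩, ⟨h2, by linarith⟩⟩
  have hex : ∀ z ∈ refTri, ∃ k ∈ s, z ∈ S k := fun z hz => by
    rw [← hcov] at hz; simpa using hz
  have hSsub : ∀ k ∈ s, S k ⊆ refTri := fun k hk => by
    rw [← hcov]; exact Set.subset_biUnion_of_mem (u := S) hk
  have hx : ∀ᵐ t ∂μ, ∀ y, ∀ k ∈ s, (t, y) ∈ S k → ‖g k (t, y)‖ₑ ≤ α t + B t := by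
    rw [hμ, ae_restrict_iff' measurableSet_Icc]
    filter_upwards [hα, hBb] with t h1 h2 ht y k hk hy
    obtain ⟨l, hl, h⟩ := hex (t, 0) ⟨ht.1, le_rfl, by simpa using ht.2⟩
    calc ‖g k (t, y)‖ₑ = ‖g l (t, 0) + (g k (t, y) - g l (t, 0))‖ₑ := by congr 1; ring
      _ ≤ _ := (enorm_add_le _ _).trans (add_le_add (h1 ht l hl h) (h2 k hk l hl y 0 hy h))
  have hy : ∀ᵐ t ∂μ, ∀ x, ∀ k ∈ s, (x, t) ∈ S k → ‖g k (x, t)‖ₑ ≤ β t + A t := by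
    rw [hμ, ae_restrict_iff' measurableSet_Icc]
    filter_upwards [hβ, hAb] with t h1 h2 ht y k hk hy
    obtain ⟨l, hl, h⟩ := hex (0, t) ⟨le_rfl, ht.1, by simpa using ht.2⟩
    calc ‖g k (y, t)‖ₑ = ‖g l (0, t) + (g k (y, t) - g l (0, t))‖ₑ := by congr 1; ring
      _ ≤ _ := (enorm_add_le _ _).trans (add_le_add (h1 ht l hl h) (h2 k hk l hl y 0 hy h))
  set H : ℝ × ℝ → ℝ≥0∞ := fun z => (α z.1 + B z.1) * (β z.2 + A z.2) with hH
  have hprod : (volume : Measure (ℝ × ℝ)).restrict (Set.Icc (0 : ℝ) 1 ×ˢ Set.Icc (0 : ℝ) 1) =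
      μ.prod μ := by
    rw [Measure.volume_eq_prod, Measure.prod_restrict]
  have hae : ∀ᵐ z ∂(μ.prod μ), ∀ k ∈ s, z ∈ S k → ‖g k z‖ₑ ^ 2 ≤ H z := by
    have h1 := Measure.quasiMeasurePreserving_fst (μ := μ) (ν := μ) |>.ae hx
    have h2 := Measure.quasiMeasurePreserving_snd (μ := μ) (ν := μ) |>.ae hy
    filter_upwards [h1, h2] with z h1 h2 k hk hz
    rw [pow_two]
    exact mul_le_mul' (h1 z.2 k hk hz) (h2 z.1 k hk hz)
  calc ∑ k ∈ s, ∫⁻ z in S k, ‖g k z‖ₑ ^ 2 ≤ ∑ k ∈ s, ∫⁻ z in S k, H z := by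
        refine Finset.sum_le_sum fun k hk => ?_
        rw [← hprod, ae_restrict_iff' (measurableSet_Icc.prod measurableSet_Icc)] at hae
        refine setLIntegral_mono_ae' (hS k hk) ?_
        filter_upwards [hae] with z h hz
        exact h (hsq (hSsub k hk hz)) k hk hz
    _ = ∫⁻ z in refTri, H z := by
        rw [← hcov, lintegral_biUnion_finset₀ (fun k hk l hl hkl => hdisj k hk l hl hkl)
          (fun k hk => (hS k hk).nullMeasurableSet)]
    _ ≤ ∫⁻ z, H z ∂(μ.prod μ) := by
        rw [← hprod]; exact lintegral_mono_set hsq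
    _ = (∫⁻ t, (α t + B t) ∂μ) * ∫⁻ t, (β t + A t) ∂μ :=
        lintegral_prod_mul (hαm.add hB.aemeasurable) (hβm.add hA.aemeasurable)
    _ ≤ _ := by
        rw [lintegral_add_right _ hB, lintegral_add_right _ hA]
        gcongr
        · exact Measure.restrict_le_self
        · exact Measure.restrict_le_self

/-- Interchange of the last two vertices. -/
def flip3 (v : Fin 3 → E2) : Fin 3 → E2 := v ∘ Equiv.swap 1 2

lemma flip3_zero (v : Fin 3 → E2) : flip3 v 0 = v 0 := rfl
lemma flip3_one (v : Fin 3 → E2) : flip3 v 1 = v 2 := rfl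
lemma flip3_two (v : Fin 3 → E2) : flip3 v 2 = v 1 := rfl

lemma tri_flip3 (v : Fin 3 → E2) : tri (flip3 v) = tri v := tri_perm v _

lemma det3_flip3 (v : Fin 3 → E2) : det3 (flip3 v) = -det3 v := by
  simp only [det3, flip3_zero, flip3_one, flip3_two]; ring

lemma par_flip3 (v : Fin 3 → E2) (z : ℝ × ℝ) : par (flip3 v) z = par v z.swap := by
  simp only [par, flip3_zero, flip3_one, flip3_two, Prod.fst_swap, Prod.snd_swap]; abel

/-- The variation of `g` along the horizontal line through the part `C` of the triangle `v`. -/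
def lineVar (v : Fin 3 → E2) (C : Set E2) (g : E2 → ℝ) (y : ℝ) : ℝ≥0∞ :=
  ∫⁻ x, (par v ⁻¹' C).indicator (fun z => ‖fderiv ℝ g (par v z)‖ₑ * ‖v 1 - v 0‖ₑ) (x, y)

lemma measurable_lineVar_integrand {v : Fin 3 → E2} {C : Set E2} (hC : MeasurableSet C)
    {g : E2 → ℝ} (hg : ContDiff ℝ 1 g) : Measurable
    ((par v ⁻¹' C).indicator (fun z => ‖fderiv ℝ g (par v z)‖ₑ * ‖v 1 - v 0‖ₑ)) := by
  have := (hg.continuous_fderiv one_ne_zero).comp (continuous_par v)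
  exact (this.enorm.measurable.mul_const _).indicator ((continuous_par v).measurable hC)

lemma measurable_lineVar (v : Fin 3 → E2) {C : Set E2} (hC : MeasurableSet C)
    {g : E2 → ℝ} (hg : ContDiff ℝ 1 g) : Measurable (lineVar v C g) :=
  (measurable_lineVar_integrand hC hg).lintegral_prod_left'

lemma lintegral_lineVar {v : Fin 3 → E2} (hv : det3 v ≠ 0) {C : Set E2} (hC : MeasurableSet C)
    {g : E2 → ℝ} (hg : ContDiff ℝ 1 g) :
    ENNReal.ofReal |det3 v| * ∫⁻ y, lineVar v C g y =
      ‖v 1 - v 0‖ₑ * ∫⁻ x in C, ‖fderiv ℝ g x‖ₑ := by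
  unfold lineVar
  rw [← lintegral_prod_symm _ (measurable_lineVar_integrand hC hg).aemeasurable,
    ← Measure.volume_eq_prod, lintegral_indicator ((continuous_par v).measurable hC),
    lintegral_mul_const' _ _ enorm_ne_top, setLIntegral_par hv _ hC]
  ring

lemma convex_slice (v : Fin 3 → E2) {C : Set E2} (hC : Convex ℝ C) (y : ℝ) :
    Convex ℝ {x : ℝ | par v (x, y) ∈ C} := by
  intro a ha b hb s t hs ht hst
  have : par v (s • a + t • b, y) = s • par v (a, y) + t • par v (b, y) := by
    obtain rfl : s = 1 - t := by linarith
    simp only [par, smul_eq_mul]; module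
  rw [Set.mem_ofPred_eq, this]
  exact hC ha hb hs ht hst

lemma enorm_sub_le_lineVar {v : Fin 3 → E2} {C : Set E2} (hC : Convex ℝ C)
    (hCm : MeasurableSet C) {g : E2 → ℝ} (hg : ContDiff ℝ 1 g) {x x' y : ℝ}
    (hx : par v (x, y) ∈ C) (hx' : par v (x', y) ∈ C) :
    ‖g (par v (x, y)) - g (par v (x', y))‖ₑ ≤ lineVar v C g y := by
  have hder : ∀ t, HasDerivAt (fun t => par v (t, y)) (v 1 - v 0) t := by
    intro t
    have := (((hasDerivAt_id t).smul_const (v 1 - v 0)).const_add (v 0)).add_const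
      (y • (v 2 - v 0))
    simpa [par] using this
  have hc : ContDiff ℝ 1 (fun t => g (par v (t, y))) := by
    refine hg.comp ?_
    unfold par; fun_prop
  refine (enorm_sub_le_lintegral hc (convex_slice v hC y).ordConnected hx hx').trans ?_
  have hm : MeasurableSet {x : ℝ | par v (x, y) ∈ C} :=
    ((continuous_par v).comp (by fun_prop : Continuous fun x : ℝ => (x, y))).measurable hCm
  rw [lineVar, ← lintegral_indicator hm]
  refine lintegral_mono fun t => ?_
  by_cases ht : par v (t, y) ∈ C
  · rw [Set.indicator_of_mem (by exact ht), Set.indicator_of_mem (by exact ht)]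
    have := ((hg.differentiable one_ne_zero) (par v (t, y))).hasFDerivAt.comp_hasDerivAt t (hder t)
    have h2 : deriv (fun t => g (par v (t, y))) t = fderiv ℝ g (par v (t, y)) (v 1 - v 0) :=
      this.deriv
    rw [h2]
    exact ContinuousLinearMap.le_opENorm _ _
  · rw [Set.indicator_of_notMem (by exact ht)]
    exact zero_le

/-- Trace estimate on a single triangle for the deviation from the mean over an edge. -/
lemma lintegral_sub_mean_le {v : Fin 3 → E2} (hv : det3 v ≠ 0) {g : E2 → ℝ}
    (hg : ContDiff ℝ 1 g) :
    ENNReal.ofReal |det3 v| * ∫⁻ s in Set.Icc (0 : ℝ) 1, ‖g (v 0 + s • (v 1 - v 0)) -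
        ∫ t in Set.Icc (0 : ℝ) 1, g (v 0 + t • (v 1 - v 0))‖ₑ ≤
      2 * ((‖v 1 - v 0‖ₑ + ‖v 2 - v 0‖ₑ) * ∫⁻ x in tri v, ‖fderiv ℝ g x‖ₑ) := by
  set m := ∫ t in Set.Icc (0 : ℝ) 1, g (v 0 + t • (v 1 - v 0)) with hm
  have hconv : Convex ℝ (tri v) := convex_convexHull ℝ _
  have hcont : Continuous fun t : ℝ => g (v 0 + t • (v 1 - v 0)) :=
    hg.continuous.comp (by fun_prop)
  have hcap : IntegrableOn (fun t : ℝ => g (v 0 + t • (v 1 - v 0))) (Set.Icc 0 1) :=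
    hcont.integrableOn_Icc
  have hv' : det3 (flip3 v) ≠ 0 := by rw [det3_flip3]; exact neg_ne_zero.2 hv
  have key := lintegral_edge_le ({()} : Finset Unit) (fun _ => refTri)
    (fun _ z => g (par v z) - m) (measurable_lineVar v (measurableSet_tri v) hg)
    (measurable_lineVar (flip3 v) (measurableSet_tri v) hg)
    (fun z hz => Set.mem_iUnion₂.2 ⟨(), by simp, hz⟩)
    (Filter.Eventually.of_forall fun y k _ l _ x x' hx hx' => by
      rw [sub_sub_sub_cancel_right]
      exact enorm_sub_le_lineVar hconv (measurableSet_tri v) hg ((par_mem_tri hv).2 hx)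
        ((par_mem_tri hv).2 hx'))
    (Filter.Eventually.of_forall fun y k _ l _ x x' hx hx' => by
      rw [sub_sub_sub_cancel_right, ← par_flip3, ← par_flip3]
      refine enorm_sub_le_lineVar hconv (measurableSet_tri v) hg ?_ ?_
      · rw [par_flip3]; exact (par_mem_tri hv).2 hx
      · rw [par_flip3]; exact (par_mem_tri hv).2 hx')
    (b := fun s => g (v 0 + s • (v 1 - v 0)) - m)
    (hcap.sub (by simp))
    (by
      rw [integral_sub hcap (by simp), ← hm]
      simp)
    (Filter.Eventually.of_forall fun s _ k _ _ => by simp [par])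
  refine (mul_le_mul_right key _).trans (le_of_eq ?_)
  have h1 := lintegral_lineVar hv (measurableSet_tri v) hg
  have h2 := lintegral_lineVar hv' (measurableSet_tri v) hg
  rw [det3_flip3, abs_neg, flip3_one, flip3_zero] at h2
  rw [mul_left_comm, mul_add, h1, h2, add_mul]

lemma enorm_le_ofReal_diam (v : Fin 3 → E2) {x y : E2} (hx : x ∈ tri v) (hy : y ∈ tri v) :
    ‖x - y‖ₑ ≤ ENNReal.ofReal (Metric.diam (tri v)) := by
  rw [← ofReal_norm]
  exact ENNReal.ofReal_le_ofReal (dist_le_diam v hx hy)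

lemma diam_sq_le {γ : ℝ} (hγ : 0 < γ) {v : Fin 3 → E2} (hv : det3 v ≠ 0) (hs : ShapeReg γ v) :
    Metric.diam (tri v) ^ 2 ≤ γ * |det3 v| := by
  refine hs.trans (mul_le_mul_of_nonneg_left ?_ hγ.le)
  exact ENNReal.toReal_le_of_le_ofReal (abs_nonneg _) (volume_tri_le hv)

/-- Scaled trace estimate under shape regularity, for an arbitrary edge. -/
lemma diam_mul_lintegral_sub_mean_le {γ : ℝ} (hγ : 0 < γ) {K : Fin 3 → E2}
    (hK : AffineIndependent ℝ K) (hs : ShapeReg γ K) {g : E2 → ℝ} (hg : ContDiff ℝ 1 g)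
    (i j : Fin 3) :
    ENNReal.ofReal (Metric.diam (tri K)) *
      ∫⁻ s in Set.Icc (0 : ℝ) 1, ‖g (K i + s • (K j - K i)) -
        ∫ t in Set.Icc (0 : ℝ) 1, g (K i + t • (K j - K i))‖ₑ ≤
      ENNReal.ofReal (4 * γ) * ∫⁻ x in tri K, ‖fderiv ℝ g x‖ₑ := by
  by_cases hij : i = j
  · subst hij; simp
  obtain ⟨σ, h0, h1⟩ := exists_perm hij
  set v := K ∘ σ with hv
  have ht : tri v = tri K := tri_perm K σ
  have hv0 : v 0 = K i := by simp [v, h0]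
  have hv1 : v 1 = K j := by simp [v, h1]
  have hdet : det3 v ≠ 0 := det3_ne_zero (hK.comp_embedding σ.toEmbedding)
  have hs' : ShapeReg γ v := by unfold ShapeReg at hs ⊢; rwa [ht]
  have hd := diam_sq_le hγ hdet hs'
  have key := lintegral_sub_mean_le hdet hg
  have e1 := enorm_le_ofReal_diam v (vertex_mem_tri v 1) (vertex_mem_tri v 0)
  have e2 := enorm_le_ofReal_diam v (vertex_mem_tri v 2) (vertex_mem_tri v 0)
  rw [hv0, hv1] at key
  rw [hv1, hv0] at e1
  rw [hv0] at e2
  rw [← ht]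
  set X := ∫⁻ s in Set.Icc (0 : ℝ) 1, ‖g (K i + s • (K j - K i)) -
        ∫ t in Set.Icc (0 : ℝ) 1, g (K i + t • (K j - K i))‖ₑ
  set Y := ∫⁻ x in tri v, ‖fderiv ℝ g x‖ₑ
  set δ := Metric.diam (tri v)
  have hδ : 0 ≤ δ := Metric.diam_nonneg
  have hD : ENNReal.ofReal |det3 v| ≠ 0 := by
    rw [Ne, ENNReal.ofReal_eq_zero, not_le]; exact abs_pos.2 hdet
  refine (ENNReal.mul_le_mul_iff_right hD ENNReal.ofReal_ne_top).1 ?_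
  calc ENNReal.ofReal |det3 v| * (ENNReal.ofReal δ * X)
      = ENNReal.ofReal δ * (ENNReal.ofReal |det3 v| * X) := by ring
    _ ≤ ENNReal.ofReal δ * (2 * ((ENNReal.ofReal δ + ENNReal.ofReal δ) * Y)) := by
        refine mul_le_mul_right (key.trans ?_) _
        gcongr
    _ = ENNReal.ofReal (4 * δ ^ 2) * Y := by
        rw [ENNReal.ofReal_mul (by norm_num), ENNReal.ofReal_pow hδ]
        norm_num; ring
    _ ≤ ENNReal.ofReal (|det3 v| * (4 * γ)) * Y := by
        gcongr ENNReal.ofReal ?_ * Y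
        linarith
    _ = _ := by rw [ENNReal.ofReal_mul (abs_nonneg _), mul_assoc]

/-- The jumps of the piecewise function `g` across the edges of `𝒦` are controlled by `e`. -/
def JumpBound (𝒦 : Finset (Fin 3 → E2)) (g : (Fin 3 → E2) → E2 → ℝ)
    (e : (Fin 3 → E2) → Fin 3 → Fin 3 → ℝ → ℝ≥0∞) : Prop :=
  ∀ K ∈ 𝒦, ∀ K' ∈ 𝒦, K ≠ K' → ∀ z ∈ tri K ∩ tri K', (∀ i, z ≠ K i) →
    ∃ i j i' j', ∃ s ∈ Set.Icc (0 : ℝ) 1, z = K i + s • (K j - K i) ∧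
      z = K' i' + s • (K' j' - K' i') ∧ ‖g K z - g K' z‖ₑ ≤ e K i j s + e K' i' j' s

lemma cy_line (v : Fin 3 → E2) (a b : E2) (s : ℝ) :
    cy v (a + s • (b - a)) = cy v a + s * (cy v b - cy v a) := by
  simp only [cy, PiLp.add_apply, PiLp.smul_apply, PiLp.sub_apply, smul_eq_mul]; ring

lemma abs_cy_sub_mul_le {v : Fin 3 → E2} (hv : det3 v ≠ 0) (a b : E2) :
    |cy v b - cy v a| * |det3 v| ≤ ‖v 1 - v 0‖ * ‖b - a‖ := by
  rw [← abs_mul]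
  have : (cy v b - cy v a) * det3 v =
      (v 1 0 - v 0 0) * (b 1 - a 1) - (v 1 1 - v 0 1) * (b 0 - a 0) := by
    simp only [cy]; field_simp; ring
  rw [this]
  refine abs_le_of_sq_le_sq ?_ (by positivity)
  rw [mul_pow, EuclideanSpace.norm_sq_eq, EuclideanSpace.norm_sq_eq]
  simp only [Fin.sum_univ_two, PiLp.sub_apply, Real.norm_eq_abs, sq_abs]
  nlinarith [sq_nonneg ((v 1 0 - v 0 0) * (b 0 - a 0) + (v 1 1 - v 0 1) * (b 1 - a 1))]

/-- An edge function, transported to the horizontal lines of the triangle `v`. -/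
def edgeVar (v : Fin 3 → E2) (a b : E2) (e : ℝ → ℝ≥0∞) (y : ℝ) : ℝ≥0∞ :=
  if cy v b = cy v a then 0
  else (Set.Icc (0 : ℝ) 1).indicator e ((y - cy v a) * (cy v b - cy v a)⁻¹)

lemma measurable_edgeVar (v : Fin 3 → E2) (a b : E2) {e : ℝ → ℝ≥0∞} (he : Measurable e) :
    Measurable (edgeVar v a b e) := by
  unfold edgeVar
  split_ifs
  · exact measurable_const
  · exact (he.indicator measurableSet_Icc).comp (by fun_prop)

lemma lintegral_comp_sub_mul_inv {F : ℝ → ℝ≥0∞} (hF : Measurable F) (a : ℝ) {c : ℝ} (hc : c ≠ 0) :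
    ∫⁻ y, F ((y - a) * c⁻¹) = ENNReal.ofReal |c| * ∫⁻ s, F s := by
  rw [lintegral_sub_right_eq_self (fun y => F (y * c⁻¹)) a,
    ← lintegral_map hF (measurable_mul_const _), Real.map_volume_mul_right (inv_ne_zero hc),
    lintegral_smul_measure, inv_inv, smul_eq_mul]

lemma lintegral_edgeVar_le {v : Fin 3 → E2} (hv : det3 v ≠ 0) (a b : E2) {e : ℝ → ℝ≥0∞}
    (he : Measurable e) :
    ENNReal.ofReal |det3 v| * ∫⁻ y, edgeVar v a b e y ≤
      ‖v 1 - v 0‖ₑ * (‖b - a‖ₑ * ∫⁻ s in Set.Icc (0 : ℝ) 1, e s) := by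
  unfold edgeVar
  split_ifs with h
  · simp
  · rw [lintegral_comp_sub_mul_inv (he.indicator measurableSet_Icc) _ (sub_ne_zero.2 h),
      lintegral_indicator measurableSet_Icc, ← mul_assoc, ← mul_assoc]
    refine mul_le_mul_left ?_ _
    rw [← ENNReal.ofReal_mul (abs_nonneg _), ← ofReal_norm, ← ofReal_norm,
      ← ENNReal.ofReal_mul (norm_nonneg _), mul_comm]
    exact ENNReal.ofReal_le_ofReal (abs_cy_sub_mul_le hv a b)

lemma le_edgeVar {v : Fin 3 → E2} {a b : E2} {e : ℝ → ℝ≥0∞} {s : ℝ} (hs : s ∈ Set.Icc (0 : ℝ) 1)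
    (hy : cy v (a + s • (b - a)) ≠ cy v a) :
    e s ≤ edgeVar v a b e (cy v (a + s • (b - a))) := by
  rw [cy_line] at hy ⊢
  have h : cy v b - cy v a ≠ 0 := fun h => hy (by rw [h]; ring)
  rw [edgeVar, if_neg (sub_ne_zero.1 h), add_sub_cancel_left, mul_assoc, mul_inv_cancel₀ h,
    mul_one, Set.indicator_of_mem hs]

/-- A piecewise smooth function on a triangulation of `T` with controlled jumps has controlled
variation along almost all lines parallel to the first edge of `T`. -/
lemma exists_lineBound {T : Fin 3 → E2} (hT : det3 T ≠ 0) {𝒦 : Finset (Fin 3 → E2)}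
    (hcov : (⋃ K ∈ 𝒦, tri K) = tri T) {g : (Fin 3 → E2) → E2 → ℝ}
    (hg : ∀ K ∈ 𝒦, ContDiff ℝ 1 (g K)) {e : (Fin 3 → E2) → Fin 3 → Fin 3 → ℝ → ℝ≥0∞}
    (he : ∀ K ∈ 𝒦, ∀ i j, Measurable (e K i j)) (hj : JumpBound 𝒦 g e) :
    ∃ A : ℝ → ℝ≥0∞, Measurable A ∧
      LineBound 𝒦 (fun K => par T ⁻¹' tri K) (fun K z => g K (par T z)) A ∧
      ENNReal.ofReal |det3 T| * ∫⁻ y, A y ≤ 4 * (ENNReal.ofReal (Metric.diam (tri T)) *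
        ∑ K ∈ 𝒦, ((∫⁻ x in tri K, ‖fderiv ℝ (g K) x‖ₑ) +
          ∑ i, ∑ j, ENNReal.ofReal (Metric.diam (tri K)) * ∫⁻ s in Set.Icc (0 : ℝ) 1, e K i j s)) := by
  set r : (Fin 3 → E2) → ℝ → ℝ≥0∞ := fun K y => lineVar T (tri K) (g K) y +
    ∑ i, ∑ j, edgeVar T (K i) (K j) (e K i j) y with hr
  have hvm : ∀ K ∈ 𝒦, Measurable (lineVar T (tri K) (g K)) := fun K hK =>
    measurable_lineVar T (measurableSet_tri K) (hg K hK)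
  have hem : ∀ K ∈ 𝒦, ∀ i j, Measurable (edgeVar T (K i) (K j) (e K i j)) := fun K hK i j =>
    measurable_edgeVar T _ _ (he K hK i j)
  have hrm : ∀ K ∈ 𝒦, Measurable (r K) := fun K hK =>
    (hvm K hK).add (Finset.measurable_fun_sum _ fun i _ =>
      Finset.measurable_fun_sum _ fun j _ => hem K hK i j)
  refine ⟨fun y => 4 * ∑ K ∈ 𝒦, r K y, (Finset.measurable_fun_sum _ hrm).const_mul _, ?_, ?_⟩
  · have hfin : (⋃ K ∈ 𝒦, Set.range fun i => cy T (K i)).Countable :=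
      (𝒦.finite_toSet.biUnion fun K _ => Set.finite_range _).countable
    filter_upwards [hfin.ae_notMem volume] with y hy
    have hgen : ∀ K ∈ 𝒦, ∀ i, y ≠ cy T (K i) := fun K hK i h =>
      hy (Set.mem_iUnion₂.2 ⟨K, hK, i, h.symm⟩)
    intro k hk l hl x x' hx hx'
    by_cases htop : ∑ K ∈ 𝒦, r K y = ∞
    · rw [htop]; simp
    have hrt : ∀ K ∈ 𝒦, r K y ≠ ∞ := fun K hK h => htop (ENNReal.sum_eq_top.2 ⟨K, hK, h⟩)
    have hlv : ∀ K ∈ 𝒦, ∀ t t', par T (t, y) ∈ tri K → par T (t', y) ∈ tri K →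
        ‖g K (par T (t, y)) - g K (par T (t', y))‖ₑ ≤ lineVar T (tri K) (g K) y :=
      fun K hK t t' ht ht' => enorm_sub_le_lineVar (convex_convexHull ℝ _) (measurableSet_tri K)
        (hg K hK) ht ht'
    have hedge : ∀ (K : Fin 3 → E2) i j, edgeVar T (K i) (K j) (e K i j) y ≤
        ∑ i, ∑ j, edgeVar T (K i) (K j) (e K i j) y := fun K i j =>
      (Finset.single_le_sum (f := fun j => edgeVar T (K i) (K j) (e K i j) y)
        (fun _ _ => zero_le) (Finset.mem_univ j)).trans
      (Finset.single_le_sum (f := fun i => ∑ j, edgeVar T (K i) (K j) (e K i j) y)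
        (fun _ _ => zero_le) (Finset.mem_univ i))
    have hcross : ∀ K ∈ 𝒦, ∀ K' ∈ 𝒦, K ≠ K' → ∀ t, par T (t, y) ∈ tri K → par T (t, y) ∈ tri K' →
        ‖g K (par T (t, y)) - g K' (par T (t, y))‖ₑ ≤
          (∑ i, ∑ j, edgeVar T (K i) (K j) (e K i j) y) +
          ∑ i, ∑ j, edgeVar T (K' i) (K' j) (e K' i j) y := by
      intro K hK K' hK' hne t ht ht'
      have hcy : cy T (par T (t, y)) = y := cy_par hT _
      obtain ⟨i, j, i', j', s, hs, h1, h2, h3⟩ := hj K hK K' hK' hne _ ⟨ht, ht'⟩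
        (fun i h => hgen K hK i (by rw [← h, hcy]))
      refine h3.trans (add_le_add ((?_ : _ ≤ _).trans (hedge K i j))
        ((?_ : _ ≤ _).trans (hedge K' i' j')))
      · rw [← hcy, h1]
        exact le_edgeVar hs (by rw [← h1, hcy]; exact hgen K hK i)
      · rw [← hcy, h2]
        exact le_edgeVar hs (by rw [← h2, hcy]; exact hgen K' hK' i')
    set J : Set ℝ := {t | par T (t, y) ∈ tri T}
    set I : (Fin 3 → E2) → Set ℝ := fun K => {t | par T (t, y) ∈ tri K}
    have hcont : Continuous fun t : ℝ => par T (t, y) := (continuous_par T).comp (by fun_prop)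
    have hsub : ∀ K ∈ 𝒦, ∀ t, t ∈ I K → t ∈ J := fun K hK t ht => by
      change par T (t, y) ∈ tri T
      rw [← hcov]; exact Set.mem_iUnion₂.2 ⟨K, hK, ht⟩
    set xs : (Fin 3 → E2) → ℝ := fun K => if h : (I K).Nonempty then h.some else 0
    have hxs : ∀ K t, t ∈ I K → xs K ∈ I K := fun K t ht => by
      have h : (I K).Nonempty := ⟨t, ht⟩
      simp only [xs, dif_pos h]; exact h.some_mem
    have habs : ∀ {a b : ℝ} {c : ℝ≥0∞}, c ≠ ∞ → ‖a - b‖ₑ ≤ c → |a - b| ≤ c.toReal := by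
      intro a b c hc h
      rw [← Real.norm_eq_abs, ← toReal_enorm]
      exact ENNReal.toReal_mono hc h
    have hchain := abs_sub_le_of_chain 𝒦 I
      (fun K _ => (isCompact_tri K).isClosed.preimage hcont)
      (convex_slice T (convex_convexHull ℝ _) y : Convex ℝ J).isPreconnected
      (fun t ht => by
        have : par T (t, y) ∈ ⋃ K ∈ 𝒦, tri K := by rw [hcov]; exact ht
        obtain ⟨K, hK, h⟩ := Set.mem_iUnion₂.1 this
        exact Set.mem_iUnion₂.2 ⟨K, hK, h⟩)
      (fun K => g K (par T (xs K, y))) (fun K => (r K y).toReal)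
      (fun K hK K' hK' ⟨t, _, h1, h2⟩ => by
        by_cases hne : K = K'
        · subst hne; simp only [sub_self, abs_zero]; positivity
        rw [← ENNReal.toReal_add (hrt K hK) (hrt K' hK')]
        refine habs (ENNReal.add_ne_top.2 ⟨hrt K hK, hrt K' hK'⟩) ?_
        rw [← edist_eq_enorm_sub]
        refine (edist_triangle4 _ (g K (par T (t, y))) (g K' (par T (t, y))) _).trans ?_
        simp only [edist_eq_enorm_sub]
        refine (add_le_add (add_le_add (hlv K hK _ _ (hxs K t h1) h1)
          (hcross K hK K' hK' hne t h1 h2)) (hlv K' hK' _ _ h2 (hxs K' t h2))).trans (le_of_eq ?_)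
        simp only [r]; abel)
      (fun K _ => ENNReal.toReal_nonneg) hk hl ⟨x, hsub k hk x hx, hx⟩ ⟨x', hsub l hl x' hx', hx'⟩
    have hchain' : ‖g k (par T (xs k, y)) - g l (par T (xs l, y))‖ₑ ≤ 2 * ∑ K ∈ 𝒦, r K y := by
      rw [← ofReal_norm, Real.norm_eq_abs]
      refine (ENNReal.ofReal_le_ofReal hchain).trans (le_of_eq ?_)
      rw [ENNReal.ofReal_mul (by norm_num), ← ENNReal.toReal_sum hrt, ENNReal.ofReal_toReal htop]
      norm_num
    have hle : ∀ K ∈ 𝒦, lineVar T (tri K) (g K) y ≤ ∑ K ∈ 𝒦, r K y := fun K hK =>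
      (le_self_add : _ ≤ r K y).trans
        (Finset.single_le_sum (f := fun K => r K y) (fun _ _ => zero_le) hK)
    rw [← edist_eq_enorm_sub]
    refine (edist_triangle4 _ (g k (par T (xs k, y))) (g l (par T (xs l, y))) _).trans ?_
    simp only [edist_eq_enorm_sub]
    refine (add_le_add (add_le_add ((hlv k hk _ _ hx (hxs k x hx)).trans (hle k hk)) hchain')
      ((hlv l hl _ _ (hxs l x' hx') hx').trans (hle l hl))).trans (le_of_eq ?_)
    ring
  · have hd : ‖T 1 - T 0‖ₑ ≤ ENNReal.ofReal (Metric.diam (tri T)) :=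
      enorm_le_ofReal_diam T (vertex_mem_tri T 1) (vertex_mem_tri T 0)
    rw [lintegral_const_mul _ (Finset.measurable_fun_sum _ hrm), mul_left_comm]
    refine mul_le_mul_right ?_ _
    rw [lintegral_finsetSum _ hrm, Finset.mul_sum, Finset.mul_sum]
    refine Finset.sum_le_sum fun K hK => ?_
    simp only [r]
    rw [lintegral_add_left (hvm K hK), mul_add, mul_add,
      lintegral_finsetSum _ fun i _ => Finset.measurable_fun_sum _ fun j _ => hem K hK i j]
    refine add_le_add ?_ ?_
    · rw [lintegral_lineVar hT (measurableSet_tri K) (hg K hK)]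
      gcongr
    · rw [Finset.mul_sum, Finset.mul_sum]
      refine Finset.sum_le_sum fun i _ => ?_
      rw [lintegral_finsetSum _ fun j _ => hem K hK i j, Finset.mul_sum, Finset.mul_sum]
      refine Finset.sum_le_sum fun j _ => ?_
      refine (lintegral_edgeVar_le hT _ _ (he K hK i j)).trans ?_
      gcongr
      exact enorm_le_ofReal_diam K (vertex_mem_tri K j) (vertex_mem_tri K i)

lemma eq_of_segment_eq {a b c d : E2} (hab : a ≠ b) (h : segment ℝ a b = segment ℝ c d) :
    (c = a ∧ d = b) ∨ (c = b ∧ d = a) := by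
  have hc : c ∈ segment ℝ a b := h ▸ left_mem_segment ℝ c d
  have hd : d ∈ segment ℝ a b := h ▸ right_mem_segment ℝ c d
  have ha : a ∈ segment ℝ c d := h ▸ left_mem_segment ℝ a b
  have hb : b ∈ segment ℝ c d := h ▸ right_mem_segment ℝ a b
  rw [segment_eq_image'] at hc hd ha hb
  obtain ⟨s, hs, rfl⟩ := hc
  obtain ⟨t, ht, rfl⟩ := hd
  obtain ⟨p, hp, ha⟩ := ha
  obtain ⟨q, hq, hb⟩ := hb
  have hne : b - a ≠ 0 := sub_ne_zero.2 hab.symm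
  have h1 : (s + p * (t - s)) • (b - a) = 0 := by
    have : (s + p * (t - s)) • (b - a) =
      (a + s • (b - a) + p • (a + t • (b - a) - (a + s • (b - a)))) - a := by module
    rw [this]; simp only at ha; rw [ha, sub_self]
  have h2 : (s + q * (t - s) - 1) • (b - a) = 0 := by
    have : (s + q * (t - s) - 1) • (b - a) =
      (a + s • (b - a) + q • (a + t • (b - a) - (a + s • (b - a)))) - b := by module
    rw [this]; simp only at hb; rw [hb, sub_self]
  have h1 := (smul_eq_zero.1 h1).resolve_right hne
  have h2 := (smul_eq_zero.1 h2).resolve_right hne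
  obtain ⟨hs0, hs1⟩ := hs
  obtain ⟨ht0, ht1⟩ := ht
  obtain ⟨hp0, hp1⟩ := hp
  obtain ⟨hq0, hq1⟩ := hq
  have h3 : (q - p) * (t - s) = 1 := by linarith
  have h4 : (t - s) * (t - s) ≥ 1 := by nlinarith [mul_self_nonneg (q - p - (t - s))]
  have h5 : (s = 0 ∧ t = 1) ∨ (s = 1 ∧ t = 0) := by
    rcases le_total s t with hst | hst
    · left; constructor <;> nlinarith
    · right; constructor <;> nlinarith
  rcases h5 with ⟨rfl, rfl⟩ | ⟨rfl, rfl⟩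
  · left; simp
  · right; simp

lemma exists_common_edge {𝒦 : Finset (Fin 3 → E2)} {S : Set E2}
    (hreg : IsRegularTriangulationOf 𝒦 S) {K K' : Fin 3 → E2} (hK : K ∈ 𝒦) (hK' : K' ∈ 𝒦)
    (hne : K ≠ K') {z : E2} (hz : z ∈ tri K ∩ tri K') (hv : ∀ i, z ≠ K i) :
    ∃ i j i' j', i ≠ j ∧ i' ≠ j' ∧ K' i' = K i ∧ K' j' = K j ∧
      tri K ∩ tri K' = segment ℝ (K i) (K j) := by
  rcases hreg.2.2 K hK K' hK' hne with h | ⟨i, h⟩ | ⟨i, j, hij, h⟩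
  · rw [h] at hz; exact hz.elim
  · rw [h] at hz; exact (hv i hz).elim
  have hKij : K i ≠ K j := fun h' => hij ((hreg.1 K hK).injective h')
  rcases hreg.2.2 K' hK' K hK (Ne.symm hne) with h' | ⟨i', h'⟩ | ⟨i', j', hij', h'⟩
  · rw [Set.inter_comm, h'] at hz; exact hz.elim
  · rw [Set.inter_comm, h] at h'
    have h1 : K i ∈ ({K' i'} : Set E2) := h' ▸ left_mem_segment ℝ _ _
    have h2 : K j ∈ ({K' i'} : Set E2) := h' ▸ right_mem_segment ℝ _ _
    rw [Set.mem_singleton_iff] at h1 h2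
    exact (hKij (h1.trans h2.symm)).elim
  · rw [Set.inter_comm, h] at h'
    rcases eq_of_segment_eq hKij h' with ⟨h1, h2⟩ | ⟨h1, h2⟩
    · exact ⟨i, j, i', j', hij, hij', h1, h2, h⟩
    · exact ⟨i, j, j', i', hij, hij'.symm, h2, h1, h⟩

lemma volume_segment_eq_zero {K : Fin 3 → E2} (hK : AffineIndependent ℝ K) {i j : Fin 3}
    (hij : i ≠ j) : volume (segment ℝ (K i) (K j)) = 0 := by
  obtain ⟨σ, h0, h1⟩ := exists_perm hij
  set v := K ∘ σ with hv
  have hv0 : v 0 = K i := by simp [v, h0]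
  have hv1 : v 1 = K j := by simp [v, h1]
  have hdet : det3 v ≠ 0 := det3_ne_zero (hK.comp_embedding σ.toEmbedding)
  have hm : MeasurableSet {x | cy v x = 0} :=
    (isClosed_singleton.preimage (continuous_cy v)).measurableSet
  have hsub : segment ℝ (K i) (K j) ⊆ {x | cy v x = 0} := by
    rw [segment_eq_image']
    rintro _ ⟨s, _, rfl⟩
    have : K i + s • (K j - K i) = par v (s, 0) := by simp [par, hv0, hv1]
    simp only [this, Set.mem_ofPred_eq, cy_par hdet]
  refine measure_mono_null hsub ?_
  have h := setLIntegral_par hdet (fun _ => 1) hm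
  rw [setLIntegral_one, setLIntegral_one] at h
  have hz : par v ⁻¹' {x | cy v x = 0} = Set.univ ×ˢ {0} := by
    ext z
    simp [cy_par hdet]
  rw [h, hz, Measure.volume_eq_prod, Measure.prod_prod]
  simp

lemma volume_inter_eq_zero {𝒦 : Finset (Fin 3 → E2)} {S : Set E2}
    (hreg : IsRegularTriangulationOf 𝒦 S) {K K' : Fin 3 → E2} (hK : K ∈ 𝒦) (hK' : K' ∈ 𝒦)
    (hne : K ≠ K') : volume (tri K ∩ tri K') = 0 := by
  rcases hreg.2.2 K hK K' hK' hne with h | ⟨i, h⟩ | ⟨i, j, hij, h⟩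
  · rw [h]; simp
  · rw [h]; simp
  · rw [h]; exact volume_segment_eq_zero (hreg.1 K hK) hij

lemma volume_par_preimage_eq_zero {T : Fin 3 → E2} (hT : det3 T ≠ 0) {S : Set E2}
    (hS : MeasurableSet S) (h0 : volume S = 0) : volume (par T ⁻¹' S) = 0 := by
  have h := setLIntegral_par hT (fun _ => 1) hS
  rw [setLIntegral_one, setLIntegral_one, h0] at h
  have := (mul_eq_zero.1 h.symm).resolve_left (by
    rw [ENNReal.ofReal_eq_zero, not_le]; exact abs_pos.2 hT)
  exact this

lemma cy_par_of_zero {T v : Fin 3 → E2} (h0 : cy T (v 0) = 0) (h1 : cy T (v 1) = 0) (z : ℝ × ℝ) :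
    cy T (par v z) = z.2 * cy T (v 2) := by
  have : cy T (par v z) = cy T (v 0) + z.1 * (cy T (v 1) - cy T (v 0)) +
      z.2 * (cy T (v 2) - cy T (v 0)) := by
    simp only [par, cy, PiLp.add_apply, PiLp.smul_apply, PiLp.sub_apply, smul_eq_mul]; ring
  rw [this, h0, h1]; ring

lemma cy_ne_zero_of_det3 {T v : Fin 3 → E2} (hT : det3 T ≠ 0) (hv : det3 v ≠ 0)
    (h0 : cy T (v 0) = 0) (h1 : cy T (v 1) = 0) : cy T (v 2) ≠ 0 := by
  intro h2
  have := cy_par_of_zero h0 h1 (cx v (T 2), cy v (T 2))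
  rw [par_cx_cy hv, h2, mul_zero] at this
  have h3 : cy T (par T (0, 1)) = 1 := cy_par hT _
  have h4 : par T (0, 1) = T 2 := by simp [par]
  rw [h4, this] at h3
  exact zero_ne_one h3

/-- A point on the first edge of `T` belongs to two elements only if it is a vertex. -/
lemma eq_vertex_of_mem_edge {T : Fin 3 → E2} (hT : det3 T ≠ 0) {𝒦 : Finset (Fin 3 → E2)}
    (hreg : IsRegularTriangulationOf 𝒦 (tri T)) {K K' : Fin 3 → E2} (hK : K ∈ 𝒦) (hK' : K' ∈ 𝒦)
    (hne : K ≠ K') {z : E2} (hz : z ∈ tri K ∩ tri K') (hz0 : cy T z = 0) : ∃ i, z = K i := by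
  by_contra! hv
  obtain ⟨i, j, i', j', hij, hij', hi, hj, hcap⟩ := exists_common_edge hreg hK hK' hne hz hv
  have hcy : ∀ L ∈ 𝒦, ∀ x ∈ tri L, 0 ≤ cy T x := fun L hL x hx => by
    have : x ∈ tri T := by rw [← hreg.2.1]; exact Set.mem_iUnion₂.2 ⟨L, hL, hx⟩
    exact ((mem_tri_iff hT).1 this).2.1
  have hzs := hz
  rw [hcap, segment_eq_image'] at hzs
  obtain ⟨s, ⟨hs0, hs1⟩, hzs⟩ := hzs
  simp only at hzs
  have hs0' : 0 < s := lt_of_le_of_ne hs0 fun h => hv i (by rw [← hzs, ← h]; simp)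
  have hs1' : s < 1 := lt_of_le_of_ne hs1 fun h => hv j (by rw [← hzs, h]; simp)
  have ha := hcy K hK _ (vertex_mem_tri K i)
  have hb := hcy K hK _ (vertex_mem_tri K j)
  rw [← hzs, cy_line] at hz0
  have ha0 : cy T (K i) = 0 := by nlinarith
  have hb0 : cy T (K j) = 0 := by nlinarith
  obtain ⟨σ, h0, h1⟩ := exists_perm hij
  obtain ⟨σ', h0', h1'⟩ := exists_perm hij'
  have htu := tri_perm K σ
  have htu' := tri_perm K' σ'
  have hdu : det3 (K ∘ σ) ≠ 0 := det3_ne_zero ((hreg.1 K hK).comp_embedding σ.toEmbedding)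
  have hdu' : det3 (K' ∘ σ') ≠ 0 := det3_ne_zero ((hreg.1 K' hK').comp_embedding σ'.toEmbedding)
  have hu0 : (K ∘ σ) 0 = K i := by simp [h0]
  have hu1 : (K ∘ σ) 1 = K j := by simp [h1]
  have hu0' : (K' ∘ σ') 0 = K i := by simp [h0', hi]
  have hu1' : (K' ∘ σ') 1 = K j := by simp [h1', hj]
  generalize K ∘ σ = u at *
  generalize K' ∘ σ' = u' at *
  have hc : 0 < cy T (u 2) := lt_of_le_of_ne (hcy K hK _ (htu ▸ vertex_mem_tri u 2))
    (cy_ne_zero_of_det3 hT hdu (hu0 ▸ ha0) (hu1 ▸ hb0)).symm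
  have hc' : 0 < cy T (u' 2) := lt_of_le_of_ne (hcy K' hK' _ (htu' ▸ vertex_mem_tri u' 2))
    (cy_ne_zero_of_det3 hT hdu' (hu0' ▸ ha0) (hu1' ▸ hb0)).symm
  have hprop : ∀ x, cy T x = cy u' x * cy T (u' 2) := fun x => by
    conv_lhs => rw [← par_cx_cy hdu' x]
    rw [cy_par_of_zero (hu0' ▸ ha0) (hu1' ▸ hb0)]
  set p : ℝ → E2 := fun ε => z + ε • (u 2 - z) with hp
  have hpc : Continuous p := by fun_prop
  have hp0 : p 0 = par u' (s, 0) := by simp [p, par, hu0', hu1', ← hzs]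
  have hx0 : cx u' (p 0) = s := by rw [hp0, cx_par hdu']
  have hy0 : cy u' (p 0) = 0 := by rw [hp0, cy_par hdu']
  have e1 : ∀ᶠ ε in nhds (0 : ℝ), 0 < cx u' (p ε) :=
    ((continuous_cx u').comp hpc).continuousAt.eventually_const_lt (by simpa [hx0] using hs0')
  have e2 : ∀ᶠ ε in nhds (0 : ℝ), cx u' (p ε) + cy u' (p ε) < 1 :=
    (((continuous_cx u').comp hpc).add ((continuous_cy u').comp hpc)).continuousAt.eventually_lt_const
      (by simpa [hx0, hy0] using hs1')
  have e3 : ∀ᶠ ε in nhds (0 : ℝ), ε < 1 := eventually_lt_nhds one_pos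
  obtain ⟨ε, ⟨⟨f1, f2⟩, f3⟩, f4⟩ := ((((e1.and e2).and e3).filter_mono nhdsWithin_le_nhds).and
    (self_mem_nhdsWithin : Set.Ioi (0 : ℝ) ∈ nhdsWithin 0 (Set.Ioi 0))).exists
  have hεpos : 0 < ε := f4
  have hcyz : cy T z = 0 := by rw [← hzs, cy_line, ha0, hb0]; ring
  have hcyp : cy T (p ε) = ε * cy T (u 2) := by
    simp only [p]; rw [cy_line, hcyz]; ring
  have hcyp' : 0 < cy T (p ε) := by rw [hcyp]; positivity
  have hmem : p ε ∈ tri K ∩ tri K' := by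
    constructor
    · refine (convex_convexHull ℝ (Set.range K)).add_smul_sub_mem hz.1 ?_ ⟨hεpos.le, f3.le⟩
      change u 2 ∈ tri K
      exact htu ▸ vertex_mem_tri u 2
    · rw [← htu', mem_tri_iff hdu']
      refine ⟨f1.le, ?_, f2.le⟩
      rw [hprop] at hcyp'
      exact (pos_of_mul_pos_left hcyp' hc'.le).le
  rw [hcap, segment_eq_image'] at hmem
  obtain ⟨t, _, ht⟩ := hmem
  simp only at ht
  rw [← ht, cy_line, ha0, hb0] at hcyp'
  simp at hcyp'

/-- The properties of the interpolation error of the Morley interpolation on the triangle `T`. -/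
structure MorleyError (T : Fin 3 → E2) (𝒦 : Finset (Fin 3 → E2)) (f : (Fin 3 → E2) → E2 → ℝ) :
    Prop where
  aff : AffineIndependent ℝ T
  reg : IsRegularTriangulationOf 𝒦 (tri T)
  smooth : ∀ K ∈ 𝒦, ContDiff ℝ 2 (f K)
  cont : ∀ K ∈ 𝒦, ∀ K' ∈ 𝒦, ∀ a, K a ∈ tri K' → f K (K a) = f K' (K a)
  mean : ∀ K ∈ 𝒦, ∀ K' ∈ 𝒦, K ≠ K' → ∀ a b, a ≠ b → tri K ∩ tri K' = segment ℝ (K a) (K b) →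
    ∀ e : E2, ∫ s in Set.Icc (0 : ℝ) 1, fderiv ℝ (f K) (K a + s • (K b - K a)) e =
      ∫ s in Set.Icc (0 : ℝ) 1, fderiv ℝ (f K') (K a + s • (K b - K a)) e
  vertex : ∀ a, ∀ K ∈ 𝒦, T a ∈ tri K → f K (T a) = 0
  normal_mean : ∀ a b, a ≠ b → ∀ nv : E2, ⟪nv, T b - T a⟫ = 0 →
    ∑ K ∈ 𝒦, ∫ s in Set.Icc (0 : ℝ) 1 ∩ {s | T a + s • (T b - T a) ∈ tri K},
      fderiv ℝ (f K) (T a + s • (T b - T a)) nv = 0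

namespace MorleyError

variable {T : Fin 3 → E2} {𝒦 : Finset (Fin 3 → E2)} {f : (Fin 3 → E2) → E2 → ℝ}

lemma det_ne_zero (h : MorleyError T 𝒦 f) : det3 T ≠ 0 := det3_ne_zero h.aff

lemma flip (h : MorleyError T 𝒦 f) : MorleyError (flip3 T) 𝒦 f where
  aff := h.aff.comp_embedding (Equiv.swap 1 2).toEmbedding
  reg := by rw [tri_flip3]; exact h.reg
  smooth := h.smooth
  cont := h.cont
  mean := h.mean
  vertex a := h.vertex (Equiv.swap 1 2 a)
  normal_mean a b hab := h.normal_mean (Equiv.swap 1 2 a) (Equiv.swap 1 2 b)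
    (fun h' => hab ((Equiv.swap 1 2).injective h'))

end MorleyError

/-- The derivative in direction `e` of the piecewise function `f` along the first edge of `T`. -/
def edgeDer (T : Fin 3 → E2) (𝒦 : Finset (Fin 3 → E2)) (f : (Fin 3 → E2) → E2 → ℝ) (e : E2)
    (s : ℝ) : ℝ :=
  ∑ K ∈ 𝒦, {s : ℝ | par T (s, 0) ∈ tri K}.indicator (fun s => fderiv ℝ (f K) (par T (s, 0)) e) s

/-- The value of the piecewise function `f` along the first edge of `T`. -/
def edgeVal (T : Fin 3 → E2) (𝒦 : Finset (Fin 3 → E2)) (f : (Fin 3 → E2) → E2 → ℝ) (s : ℝ) : ℝ :=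
  if h : ∃ K ∈ 𝒦, par T (s, 0) ∈ tri K then f h.choose (par T (s, 0)) else 0

lemma continuous_par_fst (T : Fin 3 → E2) : Continuous fun s : ℝ => par T (s, 0) :=
  (continuous_par T).comp (by fun_prop)

lemma isClosed_edge_piece (T K : Fin 3 → E2) : IsClosed {s : ℝ | par T (s, 0) ∈ tri K} :=
  (isCompact_tri K).isClosed.preimage (continuous_par_fst T)

namespace MorleyError

variable {T : Fin 3 → E2} {𝒦 : Finset (Fin 3 → E2)} {f : (Fin 3 → E2) → E2 → ℝ}

lemma contDiff_one (h : MorleyError T 𝒦 f) {K : Fin 3 → E2} (hK : K ∈ 𝒦) : ContDiff ℝ 1 (f K) :=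
  (h.smooth K hK).of_le (by norm_num)

lemma contDiff_fderiv (h : MorleyError T 𝒦 f) {K : Fin 3 → E2} (hK : K ∈ 𝒦) :
    ContDiff ℝ 1 (fderiv ℝ (f K)) :=
  (h.smooth K hK).fderiv_right (by norm_num)

lemma contDiff_fderiv_apply (h : MorleyError T 𝒦 f) {K : Fin 3 → E2} (hK : K ∈ 𝒦) (e : E2) :
    ContDiff ℝ 1 (fun x => fderiv ℝ (f K) x e) :=
  (h.contDiff_fderiv hK).clm_apply contDiff_const

lemma integrableOn_edge_piece (h : MorleyError T 𝒦 f) {K : Fin 3 → E2} (hK : K ∈ 𝒦) (e : E2) :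
    IntegrableOn ({s : ℝ | par T (s, 0) ∈ tri K}.indicator
      (fun s => fderiv ℝ (f K) (par T (s, 0)) e)) (Set.Icc 0 1) := by
  refine IntegrableOn.indicator ?_ (isClosed_edge_piece T K).measurableSet
  exact ((h.contDiff_fderiv_apply hK e).continuous.comp
    (continuous_par_fst T)).integrableOn_Icc

lemma integrableOn_edgeDer (h : MorleyError T 𝒦 f) (e : E2) :
    IntegrableOn (edgeDer T 𝒦 f e) (Set.Icc 0 1) := by
  unfold edgeDer
  exact integrable_finsetSum _ fun K hK => h.integrableOn_edge_piece hK e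

/-- The parameters of the vertices of the triangulation. -/
def vertexParams (T : Fin 3 → E2) (𝒦 : Finset (Fin 3 → E2)) : Set ℝ :=
  ⋃ K ∈ 𝒦, Set.range fun i => cx T (K i)

lemma finite_vertexParams (T : Fin 3 → E2) (𝒦 : Finset (Fin 3 → E2)) :
    (vertexParams T 𝒦).Finite :=
  𝒦.finite_toSet.biUnion fun _ _ => Set.finite_range _

lemma eq_of_notMem_vertexParams (h : MorleyError T 𝒦 f) {s : ℝ} (hs : s ∉ vertexParams T 𝒦)
    {K K' : Fin 3 → E2} (hK : K ∈ 𝒦) (hK' : K' ∈ 𝒦) (h1 : par T (s, 0) ∈ tri K)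
    (h2 : par T (s, 0) ∈ tri K') : K = K' := by
  by_contra hne
  obtain ⟨i, hi⟩ := eq_vertex_of_mem_edge h.det_ne_zero h.reg hK hK' hne ⟨h1, h2⟩
    (cy_par h.det_ne_zero _)
  refine hs (Set.mem_iUnion₂.2 ⟨K, hK, i, ?_⟩)
  simp only
  rw [← hi, cx_par h.det_ne_zero]

lemma edgeDer_eq (h : MorleyError T 𝒦 f) (e : E2) {s : ℝ} (hs : s ∉ vertexParams T 𝒦)
    {K : Fin 3 → E2} (hK : K ∈ 𝒦) (h1 : par T (s, 0) ∈ tri K) :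
    edgeDer T 𝒦 f e s = fderiv ℝ (f K) (par T (s, 0)) e := by
  unfold edgeDer
  rw [Finset.sum_eq_single_of_mem K hK]
  · exact Set.indicator_of_mem (s := {s : ℝ | par T (s, 0) ∈ tri K}) h1 _
  · intro K' hK' hne
    refine Set.indicator_of_notMem (s := {s : ℝ | par T (s, 0) ∈ tri K'}) (fun h2 => hne ?_) _
    exact h.eq_of_notMem_vertexParams hs hK' hK h2 h1

lemma edgeDer_ae_eq (h : MorleyError T 𝒦 f) (e : E2) :
    ∀ᵐ s : ℝ, s ∈ Set.Icc (0 : ℝ) 1 → ∀ K ∈ 𝒦, par T (s, 0) ∈ tri K →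
      edgeDer T 𝒦 f e s = fderiv ℝ (f K) (par T (s, 0)) e := by
  filter_upwards [(finite_vertexParams T 𝒦).countable.ae_notMem volume] with s hs _ K hK h1
  exact h.edgeDer_eq e hs hK h1

lemma edgeVal_eq (h : MorleyError T 𝒦 f) {s : ℝ} {K : Fin 3 → E2} (hK : K ∈ 𝒦)
    (h1 : par T (s, 0) ∈ tri K) : edgeVal T 𝒦 f s = f K (par T (s, 0)) := by
  have hex : ∃ K ∈ 𝒦, par T (s, 0) ∈ tri K := ⟨K, hK, h1⟩
  unfold edgeVal
  rw [dif_pos hex]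
  obtain ⟨hL, h2⟩ := hex.choose_spec
  generalize hex.choose = L at hL h2 ⊢
  by_cases hne : L = K
  · rw [hne]
  · obtain ⟨i, hi⟩ := eq_vertex_of_mem_edge h.det_ne_zero h.reg hL hK hne ⟨h2, h1⟩
      (cy_par h.det_ne_zero _)
    have := h.cont _ hL K hK i (hi ▸ h1)
    rw [hi]; exact this

lemma exists_mem_of_mem_Icc (h : MorleyError T 𝒦 f) {s : ℝ} (hs : s ∈ Set.Icc (0 : ℝ) 1) :
    ∃ K ∈ 𝒦, par T (s, 0) ∈ tri K := by
  have : par T (s, 0) ∈ tri T := (par_mem_tri h.det_ne_zero).2 ⟨hs.1, le_rfl, by simpa using hs.2⟩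
  rw [← h.reg.2.1] at this
  obtain ⟨K, hK, h1⟩ := Set.mem_iUnion₂.1 this
  exact ⟨K, hK, h1⟩

lemma continuousOn_edgeVal (h : MorleyError T 𝒦 f) :
    ContinuousOn (edgeVal T 𝒦 f) (Set.Icc 0 1) := by
  have hsub : Set.Icc (0 : ℝ) 1 ⊆ ⋃ K : 𝒦, {s : ℝ | par T (s, 0) ∈ tri K.1} := fun s hs => by
    obtain ⟨K, hK, h1⟩ := h.exists_mem_of_mem_Icc hs
    exact Set.mem_iUnion.2 ⟨⟨K, hK⟩, h1⟩
  refine ContinuousOn.mono ?_ hsub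
  refine (locallyFinite_of_finite _).continuousOn_iUnion (fun K => isClosed_edge_piece T K.1) ?_
  intro K
  refine ContinuousOn.congr (f := fun s => f K.1 (par T (s, 0))) ?_ fun s hs => h.edgeVal_eq K.2 hs
  exact ((h.smooth K.1 K.2).continuous.comp (continuous_par_fst T)).continuousOn

lemma hasDerivAt_edgeVal (h : MorleyError T 𝒦 f) {s : ℝ} (hs : s ∈ Set.Ioo (0 : ℝ) 1)
    (hv : s ∉ vertexParams T 𝒦) :
    HasDerivAt (edgeVal T 𝒦 f) (edgeDer T 𝒦 f (T 1 - T 0) s) s := by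
  obtain ⟨K, hK, h1⟩ := h.exists_mem_of_mem_Icc (Set.Ioo_subset_Icc_self hs)
  rw [h.edgeDer_eq _ hv hK h1]
  have hd : HasDerivAt (fun s : ℝ => par T (s, 0)) (T 1 - T 0) s := by
    have := (((hasDerivAt_id s).smul_const (T 1 - T 0)).const_add (T 0))
    simpa [par] using this
  have hd2 : HasDerivAt (fun s : ℝ => f K (par T (s, 0)))
      (fderiv ℝ (f K) (par T (s, 0)) (T 1 - T 0)) s :=
    (((h.contDiff_one hK).differentiable one_ne_zero) _).hasFDerivAt.comp_hasDerivAt s hd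
  refine hd2.congr_of_eventuallyEq ?_
  have hcl : IsClosed (⋃ K' ∈ 𝒦.erase K, {s : ℝ | par T (s, 0) ∈ tri K'}) :=
    isClosed_biUnion_finset fun K' _ => isClosed_edge_piece T K'
  have hns : s ∉ ⋃ K' ∈ 𝒦.erase K, {s : ℝ | par T (s, 0) ∈ tri K'} := fun hmem => by
    obtain ⟨K', hK', h2⟩ := Set.mem_iUnion₂.1 hmem
    exact Finset.ne_of_mem_erase hK'
      (h.eq_of_notMem_vertexParams hv (Finset.mem_of_mem_erase hK') hK h2 h1)
  filter_upwards [hcl.isOpen_compl.mem_nhds hns, Ioo_mem_nhds hs.1 hs.2] with t ht ht'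
  obtain ⟨L, hL, h2⟩ := h.exists_mem_of_mem_Icc (Set.Ioo_subset_Icc_self ht')
  by_cases hLK : L = K
  · subst hLK; exact h.edgeVal_eq hL h2
  · exact (ht (Set.mem_iUnion₂.2 ⟨L, Finset.mem_erase.2 ⟨hLK, hL⟩, h2⟩)).elim

lemma edgeVal_zero (h : MorleyError T 𝒦 f) : edgeVal T 𝒦 f 0 = 0 := by
  obtain ⟨K, hK, h1⟩ := h.exists_mem_of_mem_Icc (s := 0) (by simp)
  rw [h.edgeVal_eq hK h1]
  have hp : par T (0, 0) = T 0 := by simp [par]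
  rw [hp] at h1 ⊢
  exact h.vertex 0 K hK h1

lemma edgeVal_one (h : MorleyError T 𝒦 f) : edgeVal T 𝒦 f 1 = 0 := by
  obtain ⟨K, hK, h1⟩ := h.exists_mem_of_mem_Icc (s := 1) (by simp)
  rw [h.edgeVal_eq hK h1]
  have hp : par T (1, 0) = T 1 := by simp [par]
  rw [hp] at h1 ⊢
  exact h.vertex 1 K hK h1

lemma integral_edgeDer_tangent (h : MorleyError T 𝒦 f) {s : ℝ} (hs : s ∈ Set.Icc (0 : ℝ) 1) :
    ∫ t in (0 : ℝ)..s, edgeDer T 𝒦 f (T 1 - T 0) t = edgeVal T 𝒦 f s := by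
  have := integral_eq_of_hasDerivAt_off_countable_of_le (edgeVal T 𝒦 f)
    (edgeDer T 𝒦 f (T 1 - T 0)) hs.1 (finite_vertexParams T 𝒦).countable
    (h.continuousOn_edgeVal.mono (Set.Icc_subset_Icc_right hs.2))
    (fun x hx => h.hasDerivAt_edgeVal (Set.Ioo_subset_Ioo_right hs.2 hx.1) hx.2)
    ((intervalIntegrable_iff_integrableOn_Icc_of_le hs.1).2
      ((h.integrableOn_edgeDer _).mono_set (Set.Icc_subset_Icc_right hs.2)))
  rw [this, h.edgeVal_zero, sub_zero]

lemma enorm_le_lintegral_edgeDer (h : MorleyError T 𝒦 f) {s : ℝ} (hs : s ∈ Set.Icc (0 : ℝ) 1)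
    {K : Fin 3 → E2} (hK : K ∈ 𝒦) (h1 : par T (s, 0) ∈ tri K) :
    ‖f K (par T (s, 0))‖ₑ ≤ ∫⁻ t in Set.Icc (0 : ℝ) 1, ‖edgeDer T 𝒦 f (T 1 - T 0) t‖ₑ := by
  rw [← h.edgeVal_eq hK h1, ← h.integral_edgeDer_tangent hs, intervalIntegral.integral_of_le hs.1]
  refine (enorm_integral_le_lintegral_enorm _).trans ?_
  exact lintegral_mono_set (Set.Ioc_subset_Icc_self.trans (Set.Icc_subset_Icc_right hs.2))

lemma integral_edgeDer_normal (h : MorleyError T 𝒦 f) {n : E2} (hn : ⟪n, T 1 - T 0⟫ = 0) :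
    ∫ t in Set.Icc (0 : ℝ) 1, edgeDer T 𝒦 f n t = 0 := by
  unfold edgeDer
  rw [integral_finsetSum _ fun K hK => h.integrableOn_edge_piece hK n]
  refine Eq.trans ?_ (h.normal_mean 0 1 (by decide) n hn)
  refine Finset.sum_congr rfl fun K _ => ?_
  rw [setIntegral_indicator (isClosed_edge_piece T K).measurableSet]
  simp [par]

lemma edgeDer_add_smul (T : Fin 3 → E2) (𝒦 : Finset (Fin 3 → E2)) (f : (Fin 3 → E2) → E2 → ℝ)
    (e e' : E2) (c s : ℝ) :
    edgeDer T 𝒦 f (e + c • e') s = edgeDer T 𝒦 f e s + c * edgeDer T 𝒦 f e' s := by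
  unfold edgeDer
  rw [Finset.mul_sum, ← Finset.sum_add_distrib]
  refine Finset.sum_congr rfl fun K _ => ?_
  by_cases hs : par T (s, 0) ∈ tri K
  · simp only [Set.indicator_of_mem (s := {s : ℝ | par T (s, 0) ∈ tri K}) hs, map_add, map_smul,
      smul_eq_mul]
  · simp only [Set.indicator_of_notMem (s := {s : ℝ | par T (s, 0) ∈ tri K}) hs]; simp

lemma integral_edgeDer (h : MorleyError T 𝒦 f) (e : E2) :
    ∫ t in Set.Icc (0 : ℝ) 1, edgeDer T 𝒦 f e t = 0 := by
  set τ := T 1 - T 0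
  obtain ⟨n, c, hn, rfl⟩ : ∃ (n : E2) (c : ℝ), ⟪n, τ⟫ = 0 ∧ e = n + c • τ := by
    have hτ : ⟪τ, τ⟫ ≠ 0 := by
      rw [Ne, inner_self_eq_zero, sub_eq_zero]
      exact fun h' => absurd (h.aff.injective h') (by decide)
    refine ⟨e - (⟪e, τ⟫ / ⟪τ, τ⟫) • τ, ⟪e, τ⟫ / ⟪τ, τ⟫, ?_, by abel⟩
    rw [inner_sub_left, real_inner_smul_left, div_mul_cancel₀ _ hτ, sub_self]
  have ht : ∫ t in Set.Icc (0 : ℝ) 1, edgeDer T 𝒦 f τ t = 0 := by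
    rw [integral_Icc_eq_integral_Ioc, ← intervalIntegral.integral_of_le zero_le_one,
      h.integral_edgeDer_tangent (by simp), h.edgeVal_one]
  simp only [edgeDer_add_smul]
  rw [integral_add (h.integrableOn_edgeDer n) ((h.integrableOn_edgeDer τ).const_mul c),
    integral_const_mul, ht, h.integral_edgeDer_normal hn]
  simp

end MorleyError

lemma par_flip3_preimage (T : Fin 3 → E2) (S : Set E2) :
    par (flip3 T) ⁻¹' S = Prod.swap ⁻¹' (par T ⁻¹' S) := by
  ext z
  simp only [Set.mem_preimage, par_flip3]

/-- Control of the variation along both families of lines. -/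
lemma exists_lineBound_pair {T : Fin 3 → E2} (hT : det3 T ≠ 0) {𝒦 : Finset (Fin 3 → E2)}
    (hcov : (⋃ K ∈ 𝒦, tri K) = tri T) {g : (Fin 3 → E2) → E2 → ℝ}
    (hg : ∀ K ∈ 𝒦, ContDiff ℝ 1 (g K)) {e : (Fin 3 → E2) → Fin 3 → Fin 3 → ℝ → ℝ≥0∞}
    (he : ∀ K ∈ 𝒦, ∀ i j, Measurable (e K i j)) (hj : JumpBound 𝒦 g e) {M : ℝ≥0∞}
    (hM : ∑ K ∈ 𝒦, ((∫⁻ x in tri K, ‖fderiv ℝ (g K) x‖ₑ) +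
      ∑ i, ∑ j, ENNReal.ofReal (Metric.diam (tri K)) * ∫⁻ s in Set.Icc (0 : ℝ) 1, e K i j s) ≤ M) :
    ∃ A B : ℝ → ℝ≥0∞, Measurable A ∧ Measurable B ∧
      LineBound 𝒦 (fun K => par T ⁻¹' tri K) (fun K z => g K (par T z)) A ∧
      LineBound 𝒦 (fun K => Prod.swap ⁻¹' (par T ⁻¹' tri K)) (fun K z => g K (par T z.swap)) B ∧
      ENNReal.ofReal |det3 T| * (∫⁻ y, A y) ≤ 4 * (ENNReal.ofReal (Metric.diam (tri T)) * M) ∧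
      ENNReal.ofReal |det3 T| * (∫⁻ y, B y) ≤ 4 * (ENNReal.ofReal (Metric.diam (tri T)) * M) := by
  obtain ⟨A, hA, hAb, hAi⟩ := exists_lineBound hT hcov hg he hj
  have hT' : det3 (flip3 T) ≠ 0 := by rw [det3_flip3]; exact neg_ne_zero.2 hT
  obtain ⟨B, hB, hBb, hBi⟩ := exists_lineBound hT' (by rw [tri_flip3]; exact hcov) hg he hj
  rw [det3_flip3, abs_neg, tri_flip3] at hBi
  simp only [par_flip3_preimage, par_flip3] at hBb
  exact ⟨A, B, hA, hB, hAb, hBb, hAi.trans (by gcongr), hBi.trans (by gcongr)⟩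

/-- Cauchy-Schwarz inequality for piecewise functions. -/
lemma sum_lintegral_sq_le_mul {T : Fin 3 → E2} (hT : det3 T ≠ 0) {𝒦 : Finset (Fin 3 → E2)}
    (hreg : IsRegularTriangulationOf 𝒦 (tri T)) {G : (Fin 3 → E2) → E2 → ℝ≥0∞}
    (hG : ∀ K ∈ 𝒦, Measurable (G K)) :
    (∑ K ∈ 𝒦, ∫⁻ x in tri K, G K x) ^ 2 ≤
      ENNReal.ofReal |det3 T| * ∑ K ∈ 𝒦, ∫⁻ x in tri K, G K x ^ 2 := by
  have hvol : ∑ K ∈ 𝒦, volume (tri K) ≤ ENNReal.ofReal |det3 T| := by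
    rw [← measure_biUnion_finset₀ (fun K hK K' hK' hne => volume_inter_eq_zero hreg hK hK' hne)
      (fun K _ => (measurableSet_tri K).nullMeasurableSet), hreg.2.1]
    exact volume_tri_le hT
  have hc : Real.HolderConjugate 2 2 := Real.HolderConjugate.two_two
  have hK : ∀ K ∈ 𝒦, ∫⁻ x in tri K, G K x ≤
      volume (tri K) ^ (1 / 2 : ℝ) * (∫⁻ x in tri K, G K x ^ 2) ^ (1 / 2 : ℝ) := fun K hK => by
    have := ENNReal.lintegral_mul_le_Lp_mul_Lq (volume.restrict (tri K)) hc
      (f := fun _ => 1) (g := G K) aemeasurable_const (hG K hK).aemeasurable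
    simpa using this
  have hsq : ∀ a : ℝ≥0∞, (a ^ (1 / 2 : ℝ)) ^ 2 = a := fun a => by
    rw [← ENNReal.rpow_natCast, ← ENNReal.rpow_mul]; norm_num
  have hsq' : ∀ a : ℝ≥0∞, (a ^ (1 / 2 : ℝ)) ^ (2 : ℝ) = a := fun a => by
    rw [← ENNReal.rpow_mul]; norm_num
  have h2 := (Finset.sum_le_sum hK).trans (ENNReal.inner_le_Lp_mul_Lq 𝒦
    (fun K => volume (tri K) ^ (1 / 2 : ℝ))
    (fun K => (∫⁻ x in tri K, G K x ^ 2) ^ (1 / 2 : ℝ)) hc)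
  simp only [hsq'] at h2
  calc _ ≤ _ := pow_le_pow_left' h2 2
    _ = (∑ K ∈ 𝒦, volume (tri K)) * ∑ K ∈ 𝒦, ∫⁻ x in tri K, G K x ^ 2 := by
        rw [mul_pow, hsq, hsq]
    _ ≤ _ := by gcongr

namespace MorleyError

variable {T : Fin 3 → E2} {𝒦 : Finset (Fin 3 → E2)} {f : (Fin 3 → E2) → E2 → ℝ} {γ : ℝ}

lemma tri_subset (h : MorleyError T 𝒦 f) {K : Fin 3 → E2} (hK : K ∈ 𝒦) : tri K ⊆ tri T := by
  rw [← h.reg.2.1]; exact fun x hx => Set.mem_iUnion₂.2 ⟨K, hK, hx⟩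

lemma enorm_fderiv_apply_le (h : MorleyError T 𝒦 f) {K : Fin 3 → E2} (hK : K ∈ 𝒦) (e x : E2) :
    ‖fderiv ℝ (fun x => fderiv ℝ (f K) x e) x‖ₑ ≤ ‖e‖ₑ * ‖fderiv ℝ (fderiv ℝ (f K)) x‖ₑ := by
  have hd : DifferentiableAt ℝ (fderiv ℝ (f K)) x :=
    (h.contDiff_fderiv hK).differentiable one_ne_zero x
  rw [← ofReal_norm, ← ofReal_norm, ← ofReal_norm, ← ENNReal.ofReal_mul (norm_nonneg _)]
  refine ENNReal.ofReal_le_ofReal ?_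
  refine ContinuousLinearMap.opNorm_le_bound _ (by positivity) fun y => ?_
  have hfd : fderiv ℝ (fun x => fderiv ℝ (f K) x e) x y = fderiv ℝ (fderiv ℝ (f K)) x y e := by
    rw [fderiv_clm_apply hd (differentiableAt_const e)]
    simp
  rw [hfd]
  calc ‖fderiv ℝ (fderiv ℝ (f K)) x y e‖
      ≤ ‖fderiv ℝ (fderiv ℝ (f K)) x y‖ * ‖e‖ := ContinuousLinearMap.le_opNorm _ _
    _ ≤ ‖fderiv ℝ (fderiv ℝ (f K)) x‖ * ‖y‖ * ‖e‖ := by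
        gcongr; exact ContinuousLinearMap.le_opNorm _ _
    _ = ‖e‖ * ‖fderiv ℝ (fderiv ℝ (f K)) x‖ * ‖y‖ := by ring

/-- The deviation of a directional derivative from its mean over an edge. -/
def edgeDev (f : (Fin 3 → E2) → E2 → ℝ) (e : E2) (K : Fin 3 → E2) (i j : Fin 3) (s : ℝ) : ℝ≥0∞ :=
  ‖fderiv ℝ (f K) (K i + s • (K j - K i)) e -
    ∫ t in Set.Icc (0 : ℝ) 1, fderiv ℝ (f K) (K i + t • (K j - K i)) e‖ₑ

lemma continuous_edge (h : MorleyError T 𝒦 f) {K : Fin 3 → E2} (hK : K ∈ 𝒦) (e a b : E2) :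
    Continuous fun s : ℝ => fderiv ℝ (f K) (a + s • (b - a)) e :=
  (h.contDiff_fderiv_apply hK e).continuous.comp (by fun_prop)

lemma measurable_edgeDev (h : MorleyError T 𝒦 f) {K : Fin 3 → E2} (hK : K ∈ 𝒦) (e : E2)
    (i j : Fin 3) : Measurable (edgeDev f e K i j) :=
  ((h.continuous_edge hK e _ _).sub continuous_const).enorm.measurable

lemma diam_mul_lintegral_edgeDev_le (h : MorleyError T 𝒦 f) (hγ : 0 < γ) {K : Fin 3 → E2}
    (hK : K ∈ 𝒦) (hs : ShapeReg γ K) (e : E2) (i j : Fin 3) :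
    ENNReal.ofReal (Metric.diam (tri K)) * ∫⁻ s in Set.Icc (0 : ℝ) 1, edgeDev f e K i j s ≤
      ENNReal.ofReal (4 * γ) * (‖e‖ₑ * ∫⁻ x in tri K, ‖fderiv ℝ (fderiv ℝ (f K)) x‖ₑ) := by
  refine (diam_mul_lintegral_sub_mean_le hγ (h.reg.1 K hK) hs (h.contDiff_fderiv_apply hK e)
    i j).trans ?_
  rw [← lintegral_const_mul' _ _ enorm_ne_top]
  gcongr with x
  exact h.enorm_fderiv_apply_le hK e x

/-- The constant arising from the trace estimates. -/
def traceConst (γ : ℝ) : ℝ≥0∞ := 1 + 36 * ENNReal.ofReal γ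

/-- The `L¹` norm of the piecewise Hessian. -/
def hessL1 (𝒦 : Finset (Fin 3 → E2)) (f : (Fin 3 → E2) → E2 → ℝ) : ℝ≥0∞ :=
  ∑ K ∈ 𝒦, ∫⁻ x in tri K, ‖fderiv ℝ (fderiv ℝ (f K)) x‖ₑ

lemma jumpBound_fderiv (h : MorleyError T 𝒦 f) (e : E2) :
    JumpBound 𝒦 (fun K x => fderiv ℝ (f K) x e) (edgeDev f e) := by
  intro K hK K' hK' hne z hz hv
  obtain ⟨i, j, i', j', hij, hij', hi, hj, hcap⟩ := exists_common_edge h.reg hK hK' hne hz hv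
  have hm := h.mean K hK K' hK' hne i j hij hcap e
  rw [hcap, segment_eq_image'] at hz
  obtain ⟨s, hs, rfl⟩ := hz
  refine ⟨i, j, i', j', s, hs, rfl, by rw [hi, hj], ?_⟩
  simp only [edgeDev, hi, hj]
  rw [← hm]
  set m := ∫ s in Set.Icc (0 : ℝ) 1, fderiv ℝ (f K) (K i + s • (K j - K i)) e
  rw [← edist_eq_enorm_sub, ← edist_eq_enorm_sub, ← edist_eq_enorm_sub]
  exact edist_triangle_right _ _ _

lemma fderiv_lineBound (h : MorleyError T 𝒦 f) (hγ : 0 < γ) (hs : ∀ K ∈ 𝒦, ShapeReg γ K) (e : E2) :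
    ∃ A B : ℝ → ℝ≥0∞, Measurable A ∧ Measurable B ∧
      LineBound 𝒦 (fun K => par T ⁻¹' tri K) (fun K z => fderiv ℝ (f K) (par T z) e) A ∧
      LineBound 𝒦 (fun K => Prod.swap ⁻¹' (par T ⁻¹' tri K))
        (fun K z => fderiv ℝ (f K) (par T z.swap) e) B ∧
      ENNReal.ofReal |det3 T| * (∫⁻ y, A y) ≤ 4 * (ENNReal.ofReal (Metric.diam (tri T)) *
        (traceConst γ * (‖e‖ₑ * hessL1 𝒦 f))) ∧
      ENNReal.ofReal |det3 T| * (∫⁻ y, B y) ≤ 4 * (ENNReal.ofReal (Metric.diam (tri T)) *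
        (traceConst γ * (‖e‖ₑ * hessL1 𝒦 f))) := by
  refine exists_lineBound_pair h.det_ne_zero h.reg.2.1
    (g := fun K x => fderiv ℝ (f K) x e) (fun K hK => h.contDiff_fderiv_apply hK e)
    (fun K hK i j => h.measurable_edgeDev hK e i j) (h.jumpBound_fderiv e) ?_
  rw [hessL1, Finset.mul_sum, Finset.mul_sum]
  refine Finset.sum_le_sum fun K hK => ?_
  rw [traceConst, add_mul, one_mul]
  refine add_le_add ?_ ?_
  · rw [← lintegral_const_mul' _ _ enorm_ne_top]
    exact lintegral_mono fun x => h.enorm_fderiv_apply_le hK e x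
  · refine (Finset.sum_le_sum fun i _ => Finset.sum_le_sum fun j _ =>
      h.diam_mul_lintegral_edgeDev_le hγ hK (hs K hK) e i j).trans (le_of_eq ?_)
    simp only [Finset.sum_const, Finset.card_univ, Fintype.card_fin, nsmul_eq_mul]
    rw [ENNReal.ofReal_mul (by norm_num)]
    norm_num
    ring

lemma iUnion_preimage (h : MorleyError T 𝒦 f) : (⋃ K ∈ 𝒦, par T ⁻¹' tri K) = refTri := by
  rw [← Set.preimage_iUnion₂, h.reg.2.1]
  ext z
  exact par_mem_tri h.det_ne_zero

lemma lintegral_edgeDer_le (h : MorleyError T 𝒦 f) (hγ : 0 < γ) (hs : ∀ K ∈ 𝒦, ShapeReg γ K)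
    (e : E2) :
    ENNReal.ofReal |det3 T| * ∫⁻ t in Set.Icc (0 : ℝ) 1, ‖edgeDer T 𝒦 f e t‖ₑ ≤
      16 * (ENNReal.ofReal (Metric.diam (tri T)) * (traceConst γ * (‖e‖ₑ * hessL1 𝒦 f))) := by
  obtain ⟨A, B, hA, hB, hAb, hBb, hAi, hBi⟩ := h.fderiv_lineBound hγ hs e
  have := lintegral_edge_le 𝒦 _ _ hA hB h.iUnion_preimage.ge hAb hBb (h.integrableOn_edgeDer e)
    (h.integral_edgeDer e) (h.edgeDer_ae_eq e)
  calc _ ≤ ENNReal.ofReal |det3 T| * (2 * ((∫⁻ y, A y) + ∫⁻ x, B x)) := by gcongr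
    _ = 2 * (ENNReal.ofReal |det3 T| * (∫⁻ y, A y) + ENNReal.ofReal |det3 T| * (∫⁻ x, B x)) := by
        ring
    _ ≤ _ := mul_le_mul_right (add_le_add hAi hBi) _
    _ = _ := by ring

/-- The local `L²` estimate in terms of the traces on two edges and the variation along lines. -/
lemma sum_lintegral_sq_le (h : MorleyError T 𝒦 f) {g : (Fin 3 → E2) → E2 → ℝ}
    {A B α β : ℝ → ℝ≥0∞} (hA : Measurable A) (hB : Measurable B)
    (hAb : LineBound 𝒦 (fun K => par T ⁻¹' tri K) (fun K z => g K (par T z)) A)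
    (hBb : LineBound 𝒦 (fun K => Prod.swap ⁻¹' (par T ⁻¹' tri K))
      (fun K z => g K (par T z.swap)) B)
    (hαm : AEMeasurable α (volume.restrict (Set.Icc 0 1)))
    (hβm : AEMeasurable β (volume.restrict (Set.Icc 0 1)))
    (hα : ∀ᵐ t : ℝ, t ∈ Set.Icc (0 : ℝ) 1 → ∀ K ∈ 𝒦, par T (t, 0) ∈ tri K →
      ‖g K (par T (t, 0))‖ₑ ≤ α t)
    (hβ : ∀ᵐ t : ℝ, t ∈ Set.Icc (0 : ℝ) 1 → ∀ K ∈ 𝒦, par (flip3 T) (t, 0) ∈ tri K →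
      ‖g K (par (flip3 T) (t, 0))‖ₑ ≤ β t) {R : ℝ≥0∞}
    (hαB : ENNReal.ofReal |det3 T| * ((∫⁻ t in Set.Icc (0 : ℝ) 1, α t) + ∫⁻ x, B x) ≤ R)
    (hβA : ENNReal.ofReal |det3 T| * ((∫⁻ t in Set.Icc (0 : ℝ) 1, β t) + ∫⁻ y, A y) ≤ R) :
    ENNReal.ofReal |det3 T| * ∑ K ∈ 𝒦, ∫⁻ x in tri K, ‖g K x‖ₑ ^ 2 ≤ R ^ 2 := by
  have key := MorleyInterp.sum_lintegral_sq_le 𝒦 (fun K => par T ⁻¹' tri K)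
    (fun K z => g K (par T z)) hA hB
    (fun K _ => (continuous_par T).measurable (measurableSet_tri K)) h.iUnion_preimage
    (fun _ hK _ hK' hne => volume_par_preimage_eq_zero h.det_ne_zero
      ((measurableSet_tri _).inter (measurableSet_tri _))
      (volume_inter_eq_zero h.reg hK hK' hne)) hAb hBb hαm hβm hα
    (by simpa only [par_flip3, Prod.swap_prod_mk, Set.mem_preimage] using hβ)
  have hcap : ∀ K ∈ 𝒦, ∫⁻ x in tri K, ‖g K x‖ₑ ^ 2 =
      ENNReal.ofReal |det3 T| * ∫⁻ z in par T ⁻¹' tri K, ‖g K (par T z)‖ₑ ^ 2 := fun K _ =>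
    setLIntegral_par h.det_ne_zero (fun x => ‖g K x‖ₑ ^ 2) (measurableSet_tri K)
  rw [Finset.sum_congr rfl hcap, ← Finset.mul_sum]
  refine (mul_le_mul_right (mul_le_mul_right key _) _).trans ?_
  calc _ = (ENNReal.ofReal |det3 T| * ((∫⁻ t in Set.Icc (0 : ℝ) 1, α t) + ∫⁻ x, B x)) *
        (ENNReal.ofReal |det3 T| * ((∫⁻ t in Set.Icc (0 : ℝ) 1, β t) + ∫⁻ y, A y)) := by ring
    _ ≤ R * R := mul_le_mul' hαB hβA
    _ = R ^ 2 := (sq R).symm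

lemma ofReal_det_ne_zero (h : MorleyError T 𝒦 f) : ENNReal.ofReal |det3 T| ≠ 0 := by
  rw [Ne, ENNReal.ofReal_eq_zero, not_le]; exact abs_pos.2 h.det_ne_zero

/-- The squared `L²` norm of the piecewise Hessian. -/
def hessSq (𝒦 : Finset (Fin 3 → E2)) (f : (Fin 3 → E2) → E2 → ℝ) : ℝ≥0∞ :=
  ∑ K ∈ 𝒦, ∫⁻ x in tri K, ‖fderiv ℝ (fderiv ℝ (f K)) x‖ₑ ^ 2

lemma hessL1_sq_le (h : MorleyError T 𝒦 f) :
    hessL1 𝒦 f ^ 2 ≤ ENNReal.ofReal |det3 T| * hessSq 𝒦 f :=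
  sum_lintegral_sq_le_mul h.det_ne_zero h.reg fun _ hK =>
    ((h.contDiff_fderiv hK).continuous_fderiv one_ne_zero).enorm.measurable

lemma lintegral_edgeDer_flip_le (h : MorleyError T 𝒦 f) (hγ : 0 < γ)
    (hs : ∀ K ∈ 𝒦, ShapeReg γ K) (e : E2) :
    ENNReal.ofReal |det3 T| * ∫⁻ t in Set.Icc (0 : ℝ) 1, ‖edgeDer (flip3 T) 𝒦 f e t‖ₑ ≤
      16 * (ENNReal.ofReal (Metric.diam (tri T)) * (traceConst γ * (‖e‖ₑ * hessL1 𝒦 f))) := by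
  have := h.flip.lintegral_edgeDer_le hγ hs e
  rwa [det3_flip3, abs_neg, tri_flip3] at this

lemma sum_lintegral_fderiv_apply_le (h : MorleyError T 𝒦 f) (hγ : 0 < γ)
    (hs : ∀ K ∈ 𝒦, ShapeReg γ K) (e : E2) :
    ∑ K ∈ 𝒦, ∫⁻ x in tri K, ‖fderiv ℝ (f K) x e‖ₑ ^ 2 ≤
      (20 * (ENNReal.ofReal (Metric.diam (tri T)) * (traceConst γ * ‖e‖ₑ))) ^ 2 * hessSq 𝒦 f := by
  obtain ⟨A, B, hA, hB, hAb, hBb, hAi, hBi⟩ := h.fderiv_lineBound hγ hs e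
  set Q := ENNReal.ofReal (Metric.diam (tri T)) * (traceConst γ * (‖e‖ₑ * hessL1 𝒦 f)) with hQ
  have hsum : (20 : ℝ≥0∞) * Q = 16 * Q + 4 * Q := by ring
  have key := h.sum_lintegral_sq_le (g := fun K x => fderiv ℝ (f K) x e) hA hB hAb hBb
    (α := fun t => ‖edgeDer T 𝒦 f e t‖ₑ) (β := fun t => ‖edgeDer (flip3 T) 𝒦 f e t‖ₑ)
    (h.integrableOn_edgeDer e).aestronglyMeasurable.enorm
    (h.flip.integrableOn_edgeDer e).aestronglyMeasurable.enorm
    (by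
      filter_upwards [h.edgeDer_ae_eq e] with t ht h0 K hK h1
      rw [ht h0 K hK h1])
    (by
      filter_upwards [h.flip.edgeDer_ae_eq e] with t ht h0 K hK h1
      rw [ht h0 K hK h1])
    (R := 20 * Q)
    (by rw [mul_add, hsum]; exact add_le_add (h.lintegral_edgeDer_le hγ hs e) hBi)
    (by rw [mul_add, hsum]; exact add_le_add (h.lintegral_edgeDer_flip_le hγ hs e) hAi)
  refine (ENNReal.mul_le_mul_iff_right h.ofReal_det_ne_zero ENNReal.ofReal_ne_top).1
    (key.trans ?_)
  calc (20 * Q) ^ 2 = (20 * (ENNReal.ofReal (Metric.diam (tri T)) * (traceConst γ * ‖e‖ₑ))) ^ 2 *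
        hessL1 𝒦 f ^ 2 := by rw [hQ]; ring
    _ ≤ _ := mul_le_mul_right h.hessL1_sq_le _
    _ = _ := by ring

/-- The squared `L²` norm of the piecewise gradient. -/
def gradSq (𝒦 : Finset (Fin 3 → E2)) (f : (Fin 3 → E2) → E2 → ℝ) : ℝ≥0∞ :=
  ∑ K ∈ 𝒦, ∫⁻ x in tri K, ‖fderiv ℝ (f K) x‖ₑ ^ 2

lemma enorm_sq_le_basis (L : E2 →L[ℝ] ℝ) :
    ‖L‖ₑ ^ 2 ≤ ‖L (EuclideanSpace.single 0 1)‖ₑ ^ 2 + ‖L (EuclideanSpace.single 1 1)‖ₑ ^ 2 := by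
  set a := L (EuclideanSpace.single 0 1)
  set b := L (EuclideanSpace.single 1 1)
  have hn : ‖L‖ ≤ Real.sqrt (a ^ 2 + b ^ 2) := by
    refine ContinuousLinearMap.opNorm_le_bound _ (by positivity) fun x => ?_
    have hx : x = x 0 • EuclideanSpace.single 0 1 + x 1 • EuclideanSpace.single 1 1 := by
      ext i; fin_cases i <;> simp
    have hL : L x = x 0 * a + x 1 * b := by
      conv_lhs => rw [hx]
      simp only [map_add, map_smul, smul_eq_mul, a, b]
    rw [hL, EuclideanSpace.norm_eq, ← Real.sqrt_mul (by positivity), Real.norm_eq_abs]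
    refine Real.abs_le_sqrt ?_
    simp only [Fin.sum_univ_two, Real.norm_eq_abs, sq_abs]
    nlinarith [sq_nonneg (x 0 * b - x 1 * a)]
  have h2 : ‖L‖ ^ 2 ≤ ‖a‖ ^ 2 + ‖b‖ ^ 2 := by
    refine (pow_le_pow_left₀ (norm_nonneg _) hn 2).trans (le_of_eq ?_)
    rw [Real.sq_sqrt (by positivity)]; simp
  rw [← ofReal_norm, ← ofReal_norm, ← ofReal_norm, ← ENNReal.ofReal_pow (norm_nonneg _),
    ← ENNReal.ofReal_pow (norm_nonneg _), ← ENNReal.ofReal_pow (norm_nonneg _),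
    ← ENNReal.ofReal_add (by positivity) (by positivity)]
  exact ENNReal.ofReal_le_ofReal h2

lemma gradSq_le (h : MorleyError T 𝒦 f) (hγ : 0 < γ) (hs : ∀ K ∈ 𝒦, ShapeReg γ K) :
    gradSq 𝒦 f ≤ 800 * traceConst γ ^ 2 *
      (ENNReal.ofReal (Metric.diam (tri T)) ^ 2 * hessSq 𝒦 f) := by
  have h0 := h.sum_lintegral_fderiv_apply_le hγ hs (EuclideanSpace.single 0 1)
  have h1 := h.sum_lintegral_fderiv_apply_le hγ hs (EuclideanSpace.single 1 1)
  have hn : ∀ i : Fin 2, ‖(EuclideanSpace.single i 1 : E2)‖ₑ = 1 := fun i => by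
    rw [← ofReal_norm]; simp
  rw [hn] at h0 h1
  calc gradSq 𝒦 f ≤ ∑ K ∈ 𝒦, ∫⁻ x in tri K, (‖fderiv ℝ (f K) x (EuclideanSpace.single 0 1)‖ₑ ^ 2 +
        ‖fderiv ℝ (f K) x (EuclideanSpace.single 1 1)‖ₑ ^ 2) :=
        Finset.sum_le_sum fun K _ => lintegral_mono fun x => enorm_sq_le_basis _
    _ = _ := Finset.sum_congr rfl fun K hK => lintegral_add_left
        ((h.contDiff_fderiv_apply hK _).continuous.enorm.measurable.pow_const 2) _
    _ = _ := Finset.sum_add_distrib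
    _ ≤ _ := add_le_add h0 h1
    _ = _ := by ring

lemma enorm_sub_linear_le (h : MorleyError T 𝒦 f) {K : Fin 3 → E2} (hK : K ∈ 𝒦) (i j : Fin 3)
    {s : ℝ} (hs : s ∈ Set.Icc (0 : ℝ) 1) :
    ‖f K (K i + s • (K j - K i)) - (f K (K i) + s * ∫ t in Set.Icc (0 : ℝ) 1,
      fderiv ℝ (f K) (K i + t • (K j - K i)) (K j - K i))‖ₑ ≤
      ∫⁻ t in Set.Icc (0 : ℝ) 1, edgeDev f (K j - K i) K i j t := by
  have hc := h.continuous_edge hK (K j - K i) (K i) (K j)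
  set m := ∫ t in Set.Icc (0 : ℝ) 1, fderiv ℝ (f K) (K i + t • (K j - K i)) (K j - K i)
  have hd : ∀ t : ℝ, HasDerivAt (fun t : ℝ => f K (K i + t • (K j - K i)))
      (fderiv ℝ (f K) (K i + t • (K j - K i)) (K j - K i)) t := fun t => by
    have h1 : HasDerivAt (fun t : ℝ => K i + t • (K j - K i)) (K j - K i) t := by
      simpa using ((hasDerivAt_id t).smul_const (K j - K i)).const_add (K i)
    exact (((h.contDiff_one hK).differentiable one_ne_zero) _).hasFDerivAt.comp_hasDerivAt t h1
  have hftc := intervalIntegral.integral_eq_sub_of_hasDerivAt (a := 0) (b := s)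
    (fun t _ => hd t) (hc.intervalIntegrable _ _)
  have heq : f K (K i + s • (K j - K i)) - (f K (K i) + s * m) =
      ∫ t in (0 : ℝ)..s, (fderiv ℝ (f K) (K i + t • (K j - K i)) (K j - K i) - m) := by
    rw [intervalIntegral.integral_sub (hc.intervalIntegrable _ _) (by simp), hftc]
    simp; ring
  rw [heq, intervalIntegral.integral_of_le hs.1]
  refine (enorm_integral_le_lintegral_enorm _).trans ?_
  exact lintegral_mono_set (Set.Ioc_subset_Icc_self.trans (Set.Icc_subset_Icc_right hs.2))

lemma jumpBound_self (h : MorleyError T 𝒦 f) :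
    JumpBound 𝒦 f (fun K i j _ => ∫⁻ t in Set.Icc (0 : ℝ) 1, edgeDev f (K j - K i) K i j t) := by
  intro K hK K' hK' hne z hz hv
  obtain ⟨i, j, i', j', hij, hij', hi, hj, hcap⟩ := exists_common_edge h.reg hK hK' hne hz hv
  have hm := h.mean K hK K' hK' hne i j hij hcap (K j - K i)
  have hmem : K i ∈ tri K ∩ tri K' := by rw [hcap]; exact left_mem_segment ℝ _ _
  have hval := h.cont K hK K' hK' i hmem.2
  rw [hcap, segment_eq_image'] at hz
  obtain ⟨s, hs, rfl⟩ := hz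
  refine ⟨i, j, i', j', s, hs, rfl, by rw [hi, hj], ?_⟩
  have h1 := h.enorm_sub_linear_le hK i j hs
  have h2 := h.enorm_sub_linear_le hK' i' j' hs
  rw [hi, hj, ← hm, ← hval] at h2
  simp only [hi, hj]
  rw [← edist_eq_enorm_sub] at h1 h2 ⊢
  exact (edist_triangle_right _ _ _).trans (add_le_add h1 h2)

/-- The squared `L²` norm of the piecewise function. -/
def valSq (𝒦 : Finset (Fin 3 → E2)) (f : (Fin 3 → E2) → E2 → ℝ) : ℝ≥0∞ :=
  ∑ K ∈ 𝒦, ∫⁻ x in tri K, ‖f K x‖ₑ ^ 2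

lemma valSq_le_aux (h : MorleyError T 𝒦 f) (hγ : 0 < γ) (hs : ∀ K ∈ 𝒦, ShapeReg γ K) :
    ENNReal.ofReal |det3 T| * valSq 𝒦 f ≤
      (4 * (ENNReal.ofReal (Metric.diam (tri T)) *
        ∑ K ∈ 𝒦, ∫⁻ x in tri K, ‖fderiv ℝ (f K) x‖ₑ) +
      20 * (traceConst γ * (ENNReal.ofReal (Metric.diam (tri T)) ^ 2 * hessL1 𝒦 f))) ^ 2 := by
  set δ := ENNReal.ofReal (Metric.diam (tri T)) with hδ
  set H := hessL1 𝒦 f with hH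
  set G := ∑ K ∈ 𝒦, ∫⁻ x in tri K, ‖fderiv ℝ (f K) x‖ₑ with hG
  obtain ⟨A, B, hA, hB, hAb, hBb, hAi, hBi⟩ := exists_lineBound_pair h.det_ne_zero h.reg.2.1
    (fun K hK => h.contDiff_one hK) (fun _ _ _ _ => measurable_const) h.jumpBound_self
    (M := G + traceConst γ * (δ * H)) (by
      rw [Finset.sum_add_distrib]
      refine add_le_add le_rfl ?_
      rw [hH, hessL1, Finset.mul_sum, Finset.mul_sum]
      refine Finset.sum_le_sum fun K hK => ?_
      have hij : ∀ i j : Fin 3, ENNReal.ofReal (Metric.diam (tri K)) *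
          ∫⁻ _ in Set.Icc (0 : ℝ) 1, (∫⁻ t in Set.Icc (0 : ℝ) 1, edgeDev f (K j - K i) K i j t) ≤
          ENNReal.ofReal (4 * γ) * (δ * ∫⁻ x in tri K, ‖fderiv ℝ (fderiv ℝ (f K)) x‖ₑ) := by
        intro i j
        rw [setLIntegral_const, Real.volume_Icc, sub_zero, ENNReal.ofReal_one, mul_one]
        refine (h.diam_mul_lintegral_edgeDev_le hγ hK (hs K hK) _ i j).trans ?_
        gcongr
        exact enorm_le_ofReal_diam T (h.tri_subset hK (vertex_mem_tri K j))
          (h.tri_subset hK (vertex_mem_tri K i))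
      refine (Finset.sum_le_sum fun i _ => Finset.sum_le_sum fun j _ => hij i j).trans ?_
      simp only [Finset.sum_const, Finset.card_univ, Fintype.card_fin, nsmul_eq_mul]
      rw [ENNReal.ofReal_mul (by norm_num), traceConst, add_mul]
      refine le_trans (le_of_eq ?_) le_add_self
      norm_num
      ring)
  have hE : ENNReal.ofReal |det3 T| *
      (∫⁻ t in Set.Icc (0 : ℝ) 1, ‖edgeDer T 𝒦 f (T 1 - T 0) t‖ₑ) ≤
      16 * (traceConst γ * (δ ^ 2 * H)) := by
    refine (h.lintegral_edgeDer_le hγ hs _).trans ?_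
    have := enorm_le_ofReal_diam T (vertex_mem_tri T 1) (vertex_mem_tri T 0)
    calc _ ≤ 16 * (δ * (traceConst γ * (δ * H))) := by gcongr
      _ = _ := by ring
  have hE' : ENNReal.ofReal |det3 T| *
      (∫⁻ t in Set.Icc (0 : ℝ) 1, ‖edgeDer (flip3 T) 𝒦 f (flip3 T 1 - flip3 T 0) t‖ₑ) ≤
      16 * (traceConst γ * (δ ^ 2 * H)) := by
    refine (h.lintegral_edgeDer_flip_le hγ hs _).trans ?_
    have := enorm_le_ofReal_diam T (vertex_mem_tri T 2) (vertex_mem_tri T 0)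
    rw [flip3_one, flip3_zero]
    calc _ ≤ 16 * (δ * (traceConst γ * (δ * H))) := by gcongr
      _ = _ := by ring
  have hR : 4 * (δ * G) + 20 * (traceConst γ * (δ ^ 2 * H)) =
      16 * (traceConst γ * (δ ^ 2 * H)) + 4 * (δ * (G + traceConst γ * (δ * H))) := by ring
  refine h.sum_lintegral_sq_le hA hB hAb hBb
    (α := fun _ => ∫⁻ t in Set.Icc (0 : ℝ) 1, ‖edgeDer T 𝒦 f (T 1 - T 0) t‖ₑ)
    (β := fun _ => ∫⁻ t in Set.Icc (0 : ℝ) 1, ‖edgeDer (flip3 T) 𝒦 f (flip3 T 1 - flip3 T 0) t‖ₑ)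
    aemeasurable_const aemeasurable_const
    (Filter.Eventually.of_forall fun t ht K hK h1 => h.enorm_le_lintegral_edgeDer ht hK h1)
    (Filter.Eventually.of_forall fun t ht K hK h1 => h.flip.enorm_le_lintegral_edgeDer ht hK h1)
    ?_ ?_
  · rw [setLIntegral_const, Real.volume_Icc, sub_zero, ENNReal.ofReal_one, mul_one, mul_add, hR]
    exact add_le_add hE hBi
  · rw [setLIntegral_const, Real.volume_Icc, sub_zero, ENNReal.ofReal_one, mul_one, mul_add, hR]
    exact add_le_add hE' hAi

lemma add_sq_le_four_mul (a b : ℝ≥0∞) : (a + b) ^ 2 ≤ 4 * (a ^ 2 + b ^ 2) := by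
  rcases le_total a b with hab | hab
  · calc (a + b) ^ 2 ≤ (b + b) ^ 2 := by gcongr
      _ = 4 * b ^ 2 := by ring
      _ ≤ _ := by gcongr; exact le_add_self
  · calc (a + b) ^ 2 ≤ (a + a) ^ 2 := by gcongr
      _ = 4 * a ^ 2 := by ring
      _ ≤ _ := by gcongr; exact le_self_add

lemma valSq_le (h : MorleyError T 𝒦 f) (hγ : 0 < γ) (hs : ∀ K ∈ 𝒦, ShapeReg γ K) :
    valSq 𝒦 f ≤ 52800 * traceConst γ ^ 2 *
      (ENNReal.ofReal (Metric.diam (tri T)) ^ 4 * hessSq 𝒦 f) := by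
  refine (ENNReal.mul_le_mul_iff_right h.ofReal_det_ne_zero ENNReal.ofReal_ne_top).1 ?_
  refine ((h.valSq_le_aux hγ hs).trans (add_sq_le_four_mul _ _)).trans ?_
  have hG : (∑ K ∈ 𝒦, ∫⁻ x in tri K, ‖fderiv ℝ (f K) x‖ₑ) ^ 2 ≤
      ENNReal.ofReal |det3 T| * gradSq 𝒦 f :=
    sum_lintegral_sq_le_mul h.det_ne_zero h.reg fun K hK =>
      ((h.contDiff_fderiv hK).continuous).enorm.measurable
  have hH := h.hessL1_sq_le
  have hX := h.gradSq_le hγ hs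
  set δ := ENNReal.ofReal (Metric.diam (tri T))
  set G := ∑ K ∈ 𝒦, ∫⁻ x in tri K, ‖fderiv ℝ (f K) x‖ₑ
  set D := ENNReal.ofReal |det3 T|
  calc _ = 4 * (16 * (δ ^ 2 * G ^ 2) + 400 * (traceConst γ ^ 2 * (δ ^ 4 * hessL1 𝒦 f ^ 2))) := by
        ring
    _ ≤ 4 * (16 * (δ ^ 2 * (D * (800 * traceConst γ ^ 2 * (δ ^ 2 * hessSq 𝒦 f)))) +
        400 * (traceConst γ ^ 2 * (δ ^ 4 * (D * hessSq 𝒦 f)))) := by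
        gcongr
        exact hG.trans (mul_le_mul_right hX _)
    _ = _ := by ring

end MorleyError

/-! ### Quadratic polynomials -/

lemma exists_continuous_of_isQuadratic {q : E2 → ℝ} (hq : IsQuadratic q) :
    ∃ (B : E2 →L[ℝ] E2 →L[ℝ] ℝ) (L : E2 →L[ℝ] ℝ) (c : ℝ), q = fun x => B x x + L x + c := by
  obtain ⟨B, L, c, h⟩ := hq
  refine ⟨LinearMap.toContinuousLinearMap
    ((LinearMap.toContinuousLinearMap : (E2 →ₗ[ℝ] ℝ) ≃ₗ[ℝ] (E2 →L[ℝ] ℝ)).toLinearMap ∘ₗ B),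
    LinearMap.toContinuousLinearMap L, c, ?_⟩
  funext x
  simp [h]

lemma contDiff_of_isQuadratic {q : E2 → ℝ} (hq : IsQuadratic q) : ContDiff ℝ 2 q := by
  obtain ⟨B, L, c, rfl⟩ := exists_continuous_of_isQuadratic hq
  exact ((B.contDiff.clm_apply contDiff_id).add L.contDiff).add contDiff_const

lemma fderiv_quadratic (B : E2 →L[ℝ] E2 →L[ℝ] ℝ) (L : E2 →L[ℝ] ℝ) (c : ℝ) (x e : E2) :
    fderiv ℝ (fun x => B x x + L x + c) x e = B x e + B e x + L e := by
  have h : HasFDerivAt (fun x => B x x + L x + c)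
      ((B x).comp (ContinuousLinearMap.id ℝ E2) + B.flip x + L) x := by
    have h1 := (B.hasFDerivAt (x := x)).clm_apply (hasFDerivAt_id x)
    exact (h1.add L.hasFDerivAt).add_const c
  rw [h.fderiv]
  simp

lemma setIntegral_Icc_affine (α β : ℝ) :
    ∫ s in Set.Icc (0 : ℝ) 1, (α + s * β) = α + 2⁻¹ * β := by
  rw [integral_Icc_eq_integral_Ioc, ← intervalIntegral.integral_of_le zero_le_one,
    intervalIntegral.integral_add (by simp) (by apply Continuous.intervalIntegrable; fun_prop),
    intervalIntegral.integral_mul_const, integral_id]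
  simp

lemma edge_mean_quadratic {q : E2 → ℝ} (hq : IsQuadratic q) (a b e : E2) :
    ∫ s in Set.Icc (0 : ℝ) 1, fderiv ℝ q (a + s • (b - a)) e =
      fderiv ℝ q (midpoint ℝ a b) e := by
  obtain ⟨B, L, c, rfl⟩ := exists_continuous_of_isQuadratic hq
  have hm : midpoint ℝ a b = a + (2⁻¹ : ℝ) • (b - a) := by
    rw [midpoint_eq_smul_add]; simp; module
  simp only [fderiv_quadratic, hm]
  have h : ∀ s : ℝ, B (a + s • (b - a)) e + B e (a + s • (b - a)) + L e =
      (B a e + B e a + L e) + s * (B (b - a) e + B e (b - a)) := by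
    intro s
    simp only [map_add, map_smul, add_apply, smul_apply,
      smul_eq_mul]
    ring
  simp only [h, setIntegral_Icc_affine]

lemma fderiv_midpoint_quadratic {q : E2 → ℝ} (hq : IsQuadratic q) (a b : E2) :
    fderiv ℝ q (midpoint ℝ a b) (b - a) = q b - q a := by
  obtain ⟨B, L, c, rfl⟩ := exists_continuous_of_isQuadratic hq
  have hm : midpoint ℝ a b = (2⁻¹ : ℝ) • (a + b) := by
    rw [midpoint_eq_smul_add]; simp
  simp only [fderiv_quadratic, hm]
  simp only [map_add, map_smul, map_sub, add_apply,
    smul_apply, sub_apply, smul_eq_mul]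
  ring

/-! ### Arc length on a segment -/

lemma hausdorffMeasure_restrict_segment (a b : E2) (C : Set E2) :
    (μH[1] : Measure E2).restrict (segment ℝ a b ∩ C) =
      nndist a b • ((volume : Measure ℝ).restrict
        (Set.Icc (0 : ℝ) 1 ∩ {s | a + s • (b - a) ∈ C})).map fun s => a + s • (b - a) := by
  have hc : Continuous fun s : ℝ => a + s • (b - a) := by fun_prop
  have hl : (AffineMap.lineMap a b : ℝ → E2) = fun s => a + s • (b - a) := by
    funext s; simp [AffineMap.lineMap_apply, add_comm]
  ext A hA
  rw [Measure.restrict_apply hA, Measure.smul_apply, Measure.map_apply hc.measurable hA,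
    Measure.restrict_apply (hc.measurable hA), ← hausdorffMeasure_real,
    ← hausdorffMeasure_lineMap_image, hl]
  congr 1
  rw [segment_eq_image']
  ext x
  simp only [Set.mem_inter_iff, Set.mem_image, Set.mem_preimage, Set.mem_ofPred_eq]
  constructor
  · rintro ⟨hxA, ⟨s, hs, rfl⟩, hxC⟩
    exact ⟨s, ⟨hxA, hs, hxC⟩, rfl⟩
  · rintro ⟨s, ⟨hxA, hs, hxC⟩, rfl⟩
    exact ⟨hxA, ⟨s, hs, rfl⟩, hxC⟩

lemma integral_segment_inter (a b : E2) (C : Set E2) {F : E2 → ℝ}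
    (hF : Continuous F) :
    ∫ x in segment ℝ a b ∩ C, F x ∂μH[1] =
      dist a b * ∫ s in Set.Icc (0 : ℝ) 1 ∩ {s | a + s • (b - a) ∈ C},
        F (a + s • (b - a)) := by
  have hc : Continuous fun s : ℝ => a + s • (b - a) := by fun_prop
  rw [hausdorffMeasure_restrict_segment a b C, integral_smul_nnreal_measure,
    integral_map hc.aemeasurable hF.aestronglyMeasurable, NNReal.smul_def, smul_eq_mul, coe_nndist]

lemma integral_segment (a b : E2) {F : E2 → ℝ} (hF : Continuous F) :
    ∫ x in segment ℝ a b, F x ∂μH[1] =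
      dist a b * ∫ s in Set.Icc (0 : ℝ) 1, F (a + s • (b - a)) := by
  have h := integral_segment_inter a b Set.univ hF
  simpa using h

lemma sum_setIntegral_edge_pieces {T : Fin 3 → E2} (hT : AffineIndependent ℝ T)
    {𝒦 : Finset (Fin 3 → E2)} (hreg : IsRegularTriangulationOf 𝒦 (tri T)) {a b : Fin 3}
    (hab : a ≠ b) {g : ℝ → ℝ} (hg : Continuous g) :
    ∑ K ∈ 𝒦, ∫ s in Set.Icc (0 : ℝ) 1 ∩ {s | T a + s • (T b - T a) ∈ tri K}, g s =
      ∫ s in Set.Icc (0 : ℝ) 1, g s := by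
  obtain ⟨σ, rfl, rfl⟩ := exists_perm hab
  have hTσ : AffineIndependent ℝ (T ∘ σ) := hT.comp_embedding σ.toEmbedding
  have hd := det3_ne_zero hTσ
  have hreg' : IsRegularTriangulationOf 𝒦 (tri (T ∘ σ)) := by rwa [tri_perm]
  have hpar : ∀ s : ℝ, T (σ 0) + s • (T (σ 1) - T (σ 0)) = par (T ∘ σ) (s, 0) := by
    intro s; simp [par]
  have hset : ∀ K : Fin 3 → E2, {s : ℝ | T (σ 0) + s • (T (σ 1) - T (σ 0)) ∈ tri K} =
      {s : ℝ | par (T ∘ σ) (s, 0) ∈ tri K} := fun K => by simp only [hpar]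
  simp only [hset]
  have hU : Set.Icc (0 : ℝ) 1 =
      ⋃ K : 𝒦, Set.Icc (0 : ℝ) 1 ∩ {s : ℝ | par (T ∘ σ) (s, 0) ∈ tri K.1} := by
    ext s
    simp only [Set.mem_iUnion, Set.mem_inter_iff]
    refine ⟨fun hs => ?_, fun ⟨_, h, _⟩ => h⟩
    have h1 : par (T ∘ σ) (s, 0) ∈ tri (T ∘ σ) :=
      (par_mem_tri hd).2 ⟨hs.1, le_rfl, by simpa using hs.2⟩
    rw [← hreg'.2.1] at h1
    obtain ⟨K, hK, h1⟩ := Set.mem_iUnion₂.1 h1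
    exact ⟨⟨K, hK⟩, hs, h1⟩
  conv_rhs => rw [hU]
  rw [integral_iUnion_ae, tsum_fintype]
  · exact (Finset.sum_coe_sort 𝒦 fun K =>
      ∫ s in Set.Icc (0 : ℝ) 1 ∩ {s : ℝ | par (T ∘ σ) (s, 0) ∈ tri K}, g s).symm
  · exact fun K => (measurableSet_Icc.inter
      (isClosed_edge_piece (T ∘ σ) K.1).measurableSet).nullMeasurableSet
  · intro K K' hne
    refine measure_mono_null ?_
      ((MorleyError.finite_vertexParams (T ∘ σ) 𝒦).measure_zero (volume : Measure ℝ))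
    rintro s ⟨⟨_, h1⟩, _, h2⟩
    obtain ⟨i, hi⟩ := eq_vertex_of_mem_edge hd hreg' K.2 K'.2
      (fun h => hne (Subtype.ext h)) ⟨h1, h2⟩ (cy_par hd _)
    refine Set.mem_iUnion₂.2 ⟨K.1, K.2, i, ?_⟩
    simp only
    rw [← hi, cx_par hd]
  · rw [← hU]
    exact hg.integrableOn_Icc

lemma mean_quadratic_eq {p q : E2 → ℝ} (hp : IsQuadratic p) (hq : IsQuadratic q) {a b : E2}
    (hab : a ≠ b) (ha : p a = q a) (hb : p b = q b)
    (hn : ∀ nv : E2, ⟪nv, b - a⟫ = 0 →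
      fderiv ℝ p (midpoint ℝ a b) nv = fderiv ℝ q (midpoint ℝ a b) nv) (e : E2) :
    ∫ s in Set.Icc (0 : ℝ) 1, fderiv ℝ p (a + s • (b - a)) e =
      ∫ s in Set.Icc (0 : ℝ) 1, fderiv ℝ q (a + s • (b - a)) e := by
  rw [edge_mean_quadratic hp, edge_mean_quadratic hq]
  have hne : ⟪b - a, b - a⟫ ≠ 0 := inner_self_ne_zero.2 (sub_ne_zero.2 hab.symm)
  set c : ℝ := ⟪e, b - a⟫ / ⟪b - a, b - a⟫ with hc
  have h1 := hn (e - c • (b - a)) (by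
    rw [inner_sub_left, real_inner_smul_left, hc, div_mul_cancel₀ _ hne, sub_self])
  have h2 := fderiv_midpoint_quadratic hp a b
  have h3 := fderiv_midpoint_quadratic hq a b
  rw [map_sub, map_sub, map_smul, map_smul, h2, h3, ha, hb] at h1
  linarith

lemma isMorleyError {T : Fin 3 → E2} (hT : AffineIndependent ℝ T) {𝒦 : Finset (Fin 3 → E2)}
    (hreg : IsRegularTriangulationOf 𝒦 (tri T)) {v : (Fin 3 → E2) → E2 → ℝ}
    (hv : IsVPlusMorleyOn 𝒦 v) {Iv : E2 → ℝ} (hIv : IsQuadratic Iv)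
    (hval : ∀ a : Fin 3, ∀ K ∈ 𝒦, T a ∈ tri K → Iv (T a) = v K (T a))
    (hmean : ∀ a b : Fin 3, a ≠ b → ∀ nv : E2, ⟪nv, T b - T a⟫ = 0 →
      (∑ K ∈ 𝒦, ∫ x in segment ℝ (T a) (T b) ∩ tri K, fderiv ℝ (v K) x nv ∂μH[1])
        = ∫ x in segment ℝ (T a) (T b), fderiv ℝ Iv x nv ∂μH[1]) :
    MorleyError T 𝒦 fun K y => v K y - Iv y := by
  obtain ⟨w, m, hw, hvw, hm, hcont, hnormal⟩ := hv
  have hvK : ∀ K ∈ 𝒦, v K = fun x => w x + m K x := fun K hK => funext (hvw K hK)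
  have hvs : ∀ K ∈ 𝒦, ContDiff ℝ 2 (v K) := fun K hK => by
    rw [hvK K hK]
    exact hw.add (contDiff_of_isQuadratic (hm K hK))
  have hIs := contDiff_of_isQuadratic hIv
  have hline : ∀ {g : E2 → ℝ}, ContDiff ℝ 2 g → ∀ a b e : E2,
      Continuous fun s : ℝ => fderiv ℝ g (a + s • (b - a)) e := fun hg a b e =>
    ((hg.continuous_fderiv (by norm_num)).comp (by fun_prop)).clm_apply continuous_const
  have hfd : ∀ K ∈ 𝒦, ∀ x e : E2, fderiv ℝ (fun y => v K y - Iv y) x e =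
      fderiv ℝ (v K) x e - fderiv ℝ Iv x e := fun K hK x e => by
    rw [fderiv_fun_sub ((hvs K hK).differentiable (by norm_num) x)
      (hIs.differentiable (by norm_num) x)]
    rfl
  refine ⟨hT, hreg, fun K hK => (hvs K hK).sub hIs, ?_, ?_, ?_, ?_⟩
  · intro K hK K' hK' a ha
    simp only [hvw K hK, hvw K' hK', hcont K hK K' hK' a ha]
  · intro K hK K' hK' hne a b hab hcap e
    have hKab : K a ≠ K b := fun h => hab ((hreg.1 K hK).injective h)
    have ha : K a ∈ tri K' := (hcap.symm ▸ left_mem_segment ℝ (K a) (K b) :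
      K a ∈ tri K ∩ tri K').2
    have hb : K b ∈ tri K' := (hcap.symm ▸ right_mem_segment ℝ (K a) (K b) :
      K b ∈ tri K ∩ tri K').2
    have key := mean_quadratic_eq (hm K hK) (hm K' hK') hKab (hcont K hK K' hK' a ha)
      (hcont K hK K' hK' b hb) (hnormal K hK K' hK' hne a b hab hcap) e
    have hsplit : ∀ L ∈ 𝒦,
        ∫ s in Set.Icc (0 : ℝ) 1,
          fderiv ℝ (fun y => v L y - Iv y) (K a + s • (K b - K a)) e =
        (∫ s in Set.Icc (0 : ℝ) 1, fderiv ℝ w (K a + s • (K b - K a)) e) +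
          (∫ s in Set.Icc (0 : ℝ) 1, fderiv ℝ (m L) (K a + s • (K b - K a)) e) -
          ∫ s in Set.Icc (0 : ℝ) 1, fderiv ℝ Iv (K a + s • (K b - K a)) e := by
      intro L hL
      have hms := contDiff_of_isQuadratic (hm L hL)
      rw [← integral_add (hline hw _ _ _).integrableOn_Icc (hline hms _ _ _).integrableOn_Icc,
        ← integral_sub ((hline hw _ _ _).fun_add (hline hms _ _ _)).integrableOn_Icc
          (hline hIs _ _ _).integrableOn_Icc]
      refine integral_congr_ae (Filter.Eventually.of_forall fun s => ?_)
      simp only [hfd L hL]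
      rw [hvK L hL, fderiv_fun_add (hw.differentiable (by norm_num) _)
        (hms.differentiable (by norm_num) _)]
      rfl
    rw [hsplit K hK, hsplit K' hK', key]
  · intro a K hK ha
    simp only [hval a K hK ha, sub_self]
  · intro a b hab nv hnv
    have hdist : dist (T a) (T b) ≠ 0 := dist_ne_zero.2 fun h => hab (hT.injective h)
    have h1 := hmean a b hab nv hnv
    have hce : ∀ {g : E2 → ℝ}, ContDiff ℝ 2 g → Continuous fun x => fderiv ℝ g x nv :=
      fun hg => (hg.continuous_fderiv (by norm_num)).clm_apply continuous_const
    rw [integral_segment _ _ (hce hIs), Finset.sum_congr rfl fun K hK =>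
      integral_segment_inter (T a) (T b) (tri K) (hce (hvs K hK)), ← Finset.mul_sum] at h1
    have h2 := mul_left_cancel₀ hdist h1
    rw [← sum_setIntegral_edge_pieces hT hreg hab (hline hIs _ _ _)] at h2
    rw [← sub_eq_zero, ← Finset.sum_sub_distrib] at h2
    refine (Finset.sum_congr rfl fun K hK => ?_).trans h2
    rw [← integral_sub ((hline (hvs K hK) _ _ _).integrableOn_Icc.mono_set Set.inter_subset_left)
      ((hline hIs _ _ _).integrableOn_Icc.mono_set Set.inter_subset_left)]
    simp only [hfd K hK]

/-- The piecewise `L²` norms, as Bochner and as Lebesgue integrals. -/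
lemma ofReal_sum_setIntegral_norm_sq {F : Type*} [NormedAddCommGroup F]
    {𝒦 : Finset (Fin 3 → E2)} {g : (Fin 3 → E2) → E2 → F} (hg : ∀ K ∈ 𝒦, Continuous (g K)) :
    ENNReal.ofReal (∑ K ∈ 𝒦, ∫ x in tri K, ‖g K x‖ ^ 2) =
      ∑ K ∈ 𝒦, ∫⁻ x in tri K, ‖g K x‖ₑ ^ 2 := by
  rw [ENNReal.ofReal_sum_of_nonneg fun K _ => integral_nonneg fun x => sq_nonneg _]
  refine Finset.sum_congr rfl fun K hK => ?_
  rw [ofReal_integral_eq_lintegral_ofReal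
    (((hg K hK).norm.fun_pow 2).continuousOn.integrableOn_compact (isCompact_tri K))
    (Filter.Eventually.of_forall fun x => sq_nonneg _)]
  refine lintegral_congr fun x => ?_
  rw [ENNReal.ofReal_pow (norm_nonneg _), ofReal_norm]

lemma inv_mul_sqrt_le {h A X Y : ℝ} (hh : 0 ≤ h) (hA : 0 ≤ A) (hXY : X ≤ A * h ^ 2 * Y) :
    h⁻¹ * √X ≤ √A * √Y := by
  rcases hh.eq_or_lt with rfl | hpos
  · simpa using by positivity
  · rw [inv_mul_le_iff₀ hpos]
    calc √X ≤ √(A * h ^ 2 * Y) := Real.sqrt_le_sqrt hXY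
      _ = h * (√A * √Y) := by
        rw [Real.sqrt_mul (by positivity), Real.sqrt_mul hA, Real.sqrt_sq hh]; ring

namespace MorleyError

lemma le_of_ofReal_le {γ d X Y : ℝ} {n : ℕ} (N : ℕ) (hγ : 0 ≤ γ) (hd : 0 ≤ d) (hY : 0 ≤ Y)
    (h : ENNReal.ofReal X ≤ N * traceConst γ ^ 2 * (ENNReal.ofReal d ^ n * ENNReal.ofReal Y)) :
    X ≤ N * (1 + 36 * γ) ^ 2 * (d ^ n * Y) := by
  have hc : traceConst γ = ENNReal.ofReal (1 + 36 * γ) := by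
    rw [ENNReal.ofReal_add zero_le_one (by positivity), ENNReal.ofReal_mul (by norm_num)]
    simp [traceConst]
  rw [hc, ← ENNReal.ofReal_natCast, ← ENNReal.ofReal_pow (by positivity),
    ← ENNReal.ofReal_pow hd, ← ENNReal.ofReal_mul (by positivity),
    ← ENNReal.ofReal_mul (by positivity), ← ENNReal.ofReal_mul (by positivity)] at h
  exact (ENNReal.ofReal_le_ofReal_iff (by positivity)).1 h

end MorleyError

end MorleyInterp

open MorleyInterp MorleyInterp.MorleyError

/-- **Error estimate for the Morley interpolation**
(Proposition 2.5 in Gallistl, *Morley FEM for the eigenvalues of the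
biharmonic operator*).

Let `T ∈ T_ℓ` be a triangle (vertices `Tv`) and let `T_{ℓ+m}` be a regular
triangulation `𝒦` of `T`.  Any `v ∈ V + V_{ℓ+m}` (piecewise smooth pieces
`v K`, `K ∈ 𝒦`, see `IsVPlusMorleyOn`) and its Morley interpolation
`I_ℓ v = Iv` — the quadratic polynomial on `T` matching the vertex values
of `v` and the edge-mean normal derivatives of `v` on the edges of `T` —
satisfy
`‖h_T⁻²(1-I_ℓ)v‖_{L²(T)} + ‖h_T⁻¹ D_NC(1-I_ℓ)v‖_{L²(T)}
   ≲ ‖D²_NC(1-I_ℓ)v‖_{L²(T)}`.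
The constant `C` does not depend on the triangulation `T_{ℓ+m} = 𝒦`
(it depends only on `Ω` and `T₀`, through the shape-regularity parameter
`γ` of the admissible class `𝕋`). -/
theorem morley_interpolation_error_estimate (γ : ℝ) (hγ : 0 < γ) :
    ∃ C : ℝ, 0 < C ∧
      ∀ Tv : Fin 3 → E2, AffineIndependent ℝ Tv → ShapeReg γ Tv →
      ∀ 𝒦 : Finset (Fin 3 → E2), IsRegularTriangulationOf 𝒦 (tri Tv) →
        (∀ K ∈ 𝒦, ShapeReg γ K) →
      ∀ v : (Fin 3 → E2) → E2 → ℝ, IsVPlusMorleyOn 𝒦 v →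
      ∀ Iv : E2 → ℝ, IsQuadratic Iv →
        -- `I_ℓ v` matches the values of `v` at the vertices of `T`
        (∀ a : Fin 3, ∀ K ∈ 𝒦, Tv a ∈ tri K → Iv (Tv a) = v K (Tv a)) →
        -- … and the edge means of `∂v/∂ν_F` over each edge `F` of `T`
        (∀ a b : Fin 3, a ≠ b → ∀ nv : E2, ⟪nv, Tv b - Tv a⟫ = 0 →
          (∑ K ∈ 𝒦, ∫ x in segment ℝ (Tv a) (Tv b) ∩ tri K,
              fderiv ℝ (v K) x nv ∂μH[1])
            = ∫ x in segment ℝ (Tv a) (Tv b), fderiv ℝ Iv x nv ∂μH[1]) →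
        (hT Tv)⁻¹ ^ 2 *
            Real.sqrt (∑ K ∈ 𝒦, ∫ x in tri K, (v K x - Iv x) ^ 2)
          + (hT Tv)⁻¹ *
            Real.sqrt (∑ K ∈ 𝒦, ∫ x in tri K,
              ‖fderiv ℝ (fun y => v K y - Iv y) x‖ ^ 2)
          ≤ C * Real.sqrt (∑ K ∈ 𝒦, ∫ x in tri K,
              ‖fderiv ℝ (fderiv ℝ (fun y => v K y - Iv y)) x‖ ^ 2) := by
  refine ⟨√(52800 * (1 + 36 * γ) ^ 2 * γ ^ 2) + √(800 * (1 + 36 * γ) ^ 2 * γ), by positivity, ?_⟩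
  intro Tv hTv hs 𝒦 hreg hsK v hv Iv hIv hval hmean
  have E := isMorleyError hTv hreg hv hIv hval hmean
  have hX0 := ofReal_sum_setIntegral_norm_sq fun K hK => (E.smooth K hK).continuous
  have hX1 := ofReal_sum_setIntegral_norm_sq fun K hK => (E.contDiff_fderiv hK).continuous
  have hX2 := ofReal_sum_setIntegral_norm_sq fun K hK =>
    (E.contDiff_fderiv hK).continuous_fderiv one_ne_zero
  have h0 := E.valSq_le hγ hsK
  have h1 := E.gradSq_le hγ hsK
  simp only [MorleyError.valSq, MorleyError.gradSq, MorleyError.hessSq] at h0 h1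
  rw [← hX0, ← hX2] at h0
  rw [← hX1, ← hX2] at h1
  simp only [Real.norm_eq_abs, sq_abs] at h0
  set X0 := ∑ K ∈ 𝒦, ∫ x in tri K, (v K x - Iv x) ^ 2
  set X1 := ∑ K ∈ 𝒦, ∫ x in tri K, ‖fderiv ℝ (fun y => v K y - Iv y) x‖ ^ 2
  set X2 := ∑ K ∈ 𝒦, ∫ x in tri K, ‖fderiv ℝ (fderiv ℝ (fun y => v K y - Iv y)) x‖ ^ 2
  have hX2nn : 0 ≤ X2 :=
    Finset.sum_nonneg fun K _ => integral_nonneg fun x => sq_nonneg _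
  have h0' := le_of_ofReal_le 52800 hγ.le Metric.diam_nonneg hX2nn (by exact_mod_cast h0)
  have h1' := le_of_ofReal_le 800 hγ.le Metric.diam_nonneg hX2nn (by exact_mod_cast h1)
  have hh : 0 ≤ hT Tv := Real.sqrt_nonneg _
  have hd : Metric.diam (tri Tv) ^ 2 ≤ γ * hT Tv ^ 2 := by
    rw [hT, Real.sq_sqrt ENNReal.toReal_nonneg]; exact hs
  have hd4 : Metric.diam (tri Tv) ^ 4 ≤ γ ^ 2 * (hT Tv ^ 2) ^ 2 := by
    calc Metric.diam (tri Tv) ^ 4 = (Metric.diam (tri Tv) ^ 2) ^ 2 := by ring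
      _ ≤ (γ * hT Tv ^ 2) ^ 2 := by gcongr
      _ = _ := by ring
  push_cast at h0' h1'
  rw [add_mul, inv_pow]
  refine add_le_add (inv_mul_sqrt_le (by positivity) (by positivity) ?_)
    (inv_mul_sqrt_le hh (by positivity) ?_)
  · calc X0 ≤ _ := h0'
      _ ≤ 52800 * (1 + 36 * γ) ^ 2 * (γ ^ 2 * (hT Tv ^ 2) ^ 2 * X2) := by gcongr
      _ = _ := by ring
  · calc X1 ≤ _ := h1'
      _ ≤ 800 * (1 + 36 * γ) ^ 2 * (γ * hT Tv ^ 2 * X2) := by gcongr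
      _ = _ := by ring
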